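/- arXiv:hep-th/9806084 — 6 statements merged into one kernel-verified Lean document; each statement's English description precedes it below -/
import Mathlib

section
/- Let P : M^{1+m} → M(N;ℂ) be a smooth map whose values lie in the Grassmannian G_{n,N}(ℂ) (i.e. pointwise P² = P, P† = P, tr P = n), and suppose P satisfies the submodel equations [P, □P] = 0 and [P, ∂_μP] ⊗ ∂^μP + ∂^μP ⊗ [P, ∂_μP] = 0 (Kronecker product, Minkowski contraction over μ). Then for every integer j ≥ 1 the current B̃^j_μ := Σ_{k=0}^{j−1} P^{⊗k} ⊗ [P, ∂_μP] ⊗ P^{⊗(j−1−k)} (a M(N^j;ℂ)-valued current, where P^{⊗k} is the k-fold Kronecker product) is conserved: ∂^μ B̃^j_μ = ∂_0 B̃^j_0 − Σ_{k=1}^m ∂_k B̃^j_k = 0. -/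
/-!
`(1+m)`-dimensional Minkowski space `M^{1+m}` is modeled as `Fin (m+1) → ℝ` with
coordinates `x 0, x 1, ..., x m` and metric `η = diag(1, -1, ..., -1)`.
`pd μ f` is the partial derivative `∂_μ f`, `pdM` its entrywise matrix version,
`boxS`/`boxM` the d'Alembertian `□ = ∂_0² - Σ_{k=1}^m ∂_k²`, and contractions over a
repeated index `μ` are written as `∑ μ, eta μ * ⋯` (resp. `eta μ • ⋯`).
-/

noncomputable section
open Matrix
open scoped Kronecker

/-- `(1+m)`-dimensional Minkowski spacetime. -/
abbrev Spacetime (m : ℕ) := Fin (m + 1) → ℝ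

/-- Partial derivative `∂_μ`. -/
def pd {m : ℕ} {E : Type*} [NormedAddCommGroup E] [NormedSpace ℝ E]
    (μ : Fin (m + 1)) (f : Spacetime m → E) : Spacetime m → E :=
  fun x => fderiv ℝ f x (Pi.single μ 1)

/-- Entrywise partial derivative `∂_μ` of a matrix-valued function. -/
def pdM {m : ℕ} {ι κ : Type*} (μ : Fin (m + 1)) (P : Spacetime m → Matrix ι κ ℂ) :
    Spacetime m → Matrix ι κ ℂ :=
  fun x => Matrix.of fun i j => pd μ (fun y => P y i j) x

/-- The Minkowski signature `η = diag(1, -1, …, -1)` as a complex scalar: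
raising an index costs `eta μ`. -/
def eta {m : ℕ} (μ : Fin (m + 1)) : ℂ := if μ = 0 then 1 else -1

/-- d'Alembertian `□ = ∂^μ∂_μ` on scalar functions. -/
def boxS {m : ℕ} (f : Spacetime m → ℂ) : Spacetime m → ℂ :=
  fun x => ∑ μ, eta μ * pd μ (pd μ f) x

/-- d'Alembertian `□ = ∂^μ∂_μ` on matrix-valued functions. -/
def boxM {m : ℕ} {ι κ : Type*} (P : Spacetime m → Matrix ι κ ℂ) :
    Spacetime m → Matrix ι κ ℂ :=
  fun x => ∑ μ, eta μ • pdM μ (pdM μ P) x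

/-- The `j`-fold Kronecker product `A 0 ⊗ A 1 ⊗ ⋯ ⊗ A (j-1)` of a family of `N × N`
matrices, realized on the index type `Fin j → Fin N` (of cardinality `N^j`). -/
def kronPow {N j : ℕ} (A : Fin j → Matrix (Fin N) (Fin N) ℂ) :
    Matrix (Fin j → Fin N) (Fin j → Fin N) ℂ :=
  Matrix.of fun i l => ∏ t, A t (i t) (l t)

lemma pd_of_hasFDerivAt {m : ℕ} {f : Spacetime m → ℂ} {f' : Spacetime m →L[ℝ] ℂ}
    {x : Spacetime m} (h : HasFDerivAt f f' x) (μ : Fin (m + 1)) :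
    pd μ f x = f' (Pi.single μ 1) := by
  simp [pd, h.fderiv]

lemma contDiff_pd {m : ℕ} {f : Spacetime m → ℂ} (h : ContDiff ℝ (⊤ : ℕ∞) f)
    (μ : Fin (m + 1)) : ContDiff ℝ (⊤ : ℕ∞) (pd μ f) := by
  have h1 : ContDiff ℝ (⊤ : ℕ∞) (fderiv ℝ f) := h.fderiv_right (by simp)
  exact h1.clm_apply contDiff_const

lemma smooth_diff {m : ℕ} {f : Spacetime m → ℂ} (h : ContDiff ℝ (⊤ : ℕ∞) f) :
    Differentiable ℝ f := h.differentiable (by simp)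

/-- The commutator current. -/
def curr {m N : ℕ} (P : Spacetime m → Matrix (Fin N) (Fin N) ℂ) (μ : Fin (m + 1)) :
    Spacetime m → Matrix (Fin N) (Fin N) ℂ :=
  fun y => P y * pdM μ P y - pdM μ P y * P y

lemma curr_diff {m N : ℕ} (P : Spacetime m → Matrix (Fin N) (Fin N) ℂ)
    (hsmooth : ∀ i j, ContDiff ℝ (⊤ : ℕ∞) fun x => P x i j) (μ : Fin (m + 1)) (a b : Fin N) :
    Differentiable ℝ fun y => curr P μ y a b := by
  have h0 : ∀ a b, Differentiable ℝ fun y => P y a b := fun a b => smooth_diff (hsmooth a b)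
  have h1 : ∀ a b, Differentiable ℝ fun y => pd μ (fun z => P z a b) y := fun a b =>
    smooth_diff (contDiff_pd (hsmooth a b) μ)
  simp only [curr, Matrix.sub_apply, Matrix.mul_apply, pdM, Matrix.of_apply]
  fun_prop

lemma pd_curr {m N : ℕ} (P : Spacetime m → Matrix (Fin N) (Fin N) ℂ)
    (hsmooth : ∀ i j, ContDiff ℝ (⊤ : ℕ∞) fun x => P x i j) (μ : Fin (m + 1)) (a b : Fin N)
    (x : Spacetime m) :
    pd μ (fun y => curr P μ y a b) x =
      (P x * pdM μ (pdM μ P) x - pdM μ (pdM μ P) x * P x) a b := by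
  have h0 : ∀ a b, HasFDerivAt (fun y => P y a b) (fderiv ℝ (fun y => P y a b) x) x :=
    fun a b => (smooth_diff (hsmooth a b) x).hasFDerivAt
  have h1 : ∀ a b, HasFDerivAt (fun y => pdM μ P y a b)
      (fderiv ℝ (fun y => pdM μ P y a b) x) x := fun a b =>
    (smooth_diff (contDiff_pd (hsmooth a b) μ) x).hasFDerivAt
  have h2 : HasFDerivAt (fun y => ∑ c, P y a c * pdM μ P y c b) _ x :=
    HasFDerivAt.fun_sum (u := Finset.univ) (fun c _ => (h0 a c).mul (h1 c b))
  have h3 : HasFDerivAt (fun y => ∑ c, pdM μ P y a c * P y c b) _ x :=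
    HasFDerivAt.fun_sum (u := Finset.univ) (fun c _ => (h1 a c).mul (h0 c b))
  have h4 := pd_of_hasFDerivAt (h2.sub h3) μ
  have e : (fun y => curr P μ y a b) = ((fun y => ∑ c, P y a c * pdM μ P y c b) -
      fun y => ∑ c, pdM μ P y a c * P y c b) := by
    funext y
    simp [curr, Matrix.mul_apply]
  have hp : ∀ a b, fderiv ℝ (fun y => P y a b) x (Pi.single μ 1) = pdM μ P x a b :=
    fun _ _ => rfl
  have hpp : ∀ a b, fderiv ℝ (fun y => pdM μ P y a b) x (Pi.single μ 1)
      = pdM μ (pdM μ P) x a b := fun _ _ => rfl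
  rw [e, h4]
  simp only [_root_.sub_apply, _root_.sum_apply, _root_.add_apply, _root_.smul_apply,
    hp, hpp, Matrix.sub_apply, Matrix.mul_apply, smul_eq_mul, ← Finset.sum_sub_distrib]
  refine Finset.sum_congr rfl fun c _ => ?_
  ring

/-- If a smooth `G_{n,N}(ℂ)`-valued field `P` on `M^{1+m}` satisfies the
submodel equations `[P, □P] = 0` and `[P,∂_μP] ⊗ ∂^μP + ∂^μP ⊗ [P,∂_μP] = 0`, then for
every `j ≥ 1` the current `B̃^j_μ = Σ_{k=0}^{j-1} P^{⊗k} ⊗ [P,∂_μP] ⊗ P^{⊗(j-1-k)}` is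
conserved: `∂^μ B̃^j_μ = 0`. -/
theorem statement0 {m N n : ℕ} (hn : 1 ≤ n) (hnN : n < N)
    (P : Spacetime m → Matrix (Fin N) (Fin N) ℂ)
    (hsmooth : ∀ i j, ContDiff ℝ (⊤ : ℕ∞) fun x => P x i j)
    (hproj : ∀ x, P x * P x = P x)
    (hherm : ∀ x, (P x)ᴴ = P x)
    (htr : ∀ x, Matrix.trace (P x) = (n : ℂ))
    (heom : ∀ x, P x * boxM P x - boxM P x * P x = 0)
    (hsub : ∀ x, ∑ μ, eta μ •
        ((P x * pdM μ P x - pdM μ P x * P x) ⊗ₖ pdM μ P x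
          + pdM μ P x ⊗ₖ (P x * pdM μ P x - pdM μ P x * P x)) = 0)
    (j : ℕ) (hj : 1 ≤ j) :
    ∀ x, ∑ μ, eta μ • pdM μ (fun y =>
        ∑ k : Fin j, kronPow (fun t =>
          if t = k then P y * pdM μ P y - pdM μ P y * P y else P y)) x = 0 := by
  intro x
  ext i l
  set X : Fin (m + 1) → Fin j → Fin j → ℂ := fun μ k s =>
    (∏ t ∈ Finset.univ.erase s, (if t = k then curr P μ x else P x) (i t) (l t)) *
      pd μ (fun y => (if s = k then curr P μ y else P y) (i s) (l s)) x with hX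
  have hG : ∀ μ k s, Differentiable ℝ
      (fun y => (if s = k then curr P μ y else P y) (i s) (l s)) := by
    intro μ k s
    by_cases h : s = k
    · simpa only [h, if_true] using curr_diff P hsmooth μ (i k) (l k)
    · simpa only [h, if_false] using smooth_diff (hsmooth (i s) (l s))
  have hder : ∀ μ, pdM μ (fun y => ∑ k : Fin j, kronPow (fun t =>
      if t = k then P y * pdM μ P y - pdM μ P y * P y else P y)) x i l
      = ∑ k, ∑ s, X μ k s := by
    intro μ
    have h1 : HasFDerivAt (fun y => ∑ k : Fin j, ∏ s : Fin j,
        (if s = k then curr P μ y else P y) (i s) (l s)) _ x :=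
      HasFDerivAt.fun_sum (u := Finset.univ) (fun k _ =>
        HasFDerivAt.finset_prod (u := Finset.univ)
          (fun s _ => (hG μ k s x).hasFDerivAt))
    have h2 := pd_of_hasFDerivAt h1 μ
    have e : (fun y => (∑ k : Fin j, kronPow (fun t =>
        if t = k then P y * pdM μ P y - pdM μ P y * P y else P y)) i l) =
        (fun y => ∑ k : Fin j, ∏ s : Fin j,
        (if s = k then curr P μ y else P y) (i s) (l s)) := by
      funext y
      simp only [Matrix.sum_apply, kronPow, Matrix.of_apply, curr]
    simp only [pdM, Matrix.of_apply]
    simp only [pdM] at e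
    rw [e, h2]
    simp only [_root_.sum_apply, _root_.smul_apply, smul_eq_mul, hX, pd]
  have hanti : ∀ k s, (∑ μ, eta μ * X μ k s) + (∑ μ, eta μ * X μ s k) = 0 := by
    intro k s
    by_cases h : s = k
    · subst h
      have : ∑ μ, eta μ * X μ s s = 0 := by
        have h1 : ∀ μ, eta μ * X μ s s = (∏ t ∈ Finset.univ.erase s, P x (i t) (l t)) *
            (eta μ * (P x * pdM μ (pdM μ P) x - pdM μ (pdM μ P) x * P x) (i s) (l s)) := by
          intro μ
          have h2 : ∏ t ∈ Finset.univ.erase s,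
              (if t = s then curr P μ x else P x) (i t) (l t) =
              ∏ t ∈ Finset.univ.erase s, P x (i t) (l t) :=
            Finset.prod_congr rfl fun t ht => by rw [if_neg (Finset.ne_of_mem_erase ht)]
          simp only [hX, h2, if_true, pd_curr P hsmooth]
          ring
        simp only [h1]
        rw [← Finset.mul_sum]
        have h3 := congrFun (congrFun (heom x) (i s)) (l s)
        simp only [boxM, Matrix.mul_sum, Matrix.sum_mul, Matrix.mul_smul, Matrix.smul_mul,
          ← Finset.sum_sub_distrib, ← smul_sub, Matrix.sum_apply, Matrix.smul_apply,
          smul_eq_mul, Matrix.zero_apply] at h3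
        rw [h3, mul_zero]
      rw [this, add_zero]
    · have key : ∀ k s : Fin j, s ≠ k → ∀ μ, X μ k s =
          (∏ t ∈ (Finset.univ.erase s).erase k, P x (i t) (l t)) *
            (curr P μ x (i k) (l k) * pdM μ P x (i s) (l s)) := by
        intro k s h μ
        have hk : k ∈ Finset.univ.erase s := by simp [Ne.symm h]
        have h2 : ∏ t ∈ (Finset.univ.erase s).erase k,
              (if t = k then curr P μ x else P x) (i t) (l t) =
              ∏ t ∈ (Finset.univ.erase s).erase k, P x (i t) (l t) :=
            Finset.prod_congr rfl fun t ht => by rw [if_neg (Finset.ne_of_mem_erase ht)]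
        simp only [hX, ← Finset.mul_prod_erase _ _ hk, h2, if_true, if_neg h, pdM,
          Matrix.of_apply]
        ring
      have h3 := congrFun (congrFun (hsub x) (i k, i s)) (l k, l s)
      simp only [Matrix.sum_apply, Matrix.smul_apply, Matrix.add_apply,
        Matrix.kroneckerMap_apply, smul_eq_mul, Matrix.zero_apply] at h3
      rw [← Finset.sum_add_distrib]
      have h4 : ∀ μ, eta μ * X μ k s + eta μ * X μ s k =
          (∏ t ∈ (Finset.univ.erase s).erase k, P x (i t) (l t)) *
          (eta μ * (curr P μ x (i k) (l k) * pdM μ P x (i s) (l s) +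
            pdM μ P x (i k) (l k) * curr P μ x (i s) (l s))) := by
        intro μ
        rw [key k s h, key s k (Ne.symm h), Finset.erase_right_comm (a := k)]
        ring
      simp only [h4]
      rw [← Finset.mul_sum]
      simp only [curr]
      rw [h3, mul_zero]
  simp only [Matrix.sum_apply, Matrix.smul_apply, hder, smul_eq_mul, Matrix.zero_apply]
  have e : ∑ μ, eta μ * ∑ k, ∑ s, X μ k s = ∑ k, ∑ s, ∑ μ, eta μ * X μ k s := by
    simp only [Finset.mul_sum]
    rw [Finset.sum_comm]
    exact Finset.sum_congr rfl fun k _ => Finset.sum_comm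
  rw [e]
  have h5 : (∑ k, ∑ s, ∑ μ, eta μ * X μ k s) + (∑ k, ∑ s, ∑ μ, eta μ * X μ k s) = 0 := by
    conv_lhs => rhs; rw [Finset.sum_comm]
    simp only [← Finset.sum_add_distrib (s := (Finset.univ : Finset (Fin j)))]
    exact Finset.sum_eq_zero fun k _ => Finset.sum_eq_zero fun s _ => hanti k s
  exact self_eq_neg.mp (eq_neg_of_add_eq_zero_left h5)
end
end

section
/- Let u : M^{1+m} → ℂ be a smooth function satisfying □u = 0 and ∂^μu ∂_μu = 0. Then for every integer j ≥ 1 and every integer k with 0 ≤ k ≤ j, the ℂ-valued current B̃^j_{μ:k} := (1/(1+|u|²)^{j+1}) { j(∂_μu·ū − u·∂_μū) u^k − k(1+|u|²) u^{k−1} ∂_μu } (with the convention u^{−1}∂_μu := 0 when k = 0) is conserved, ∂^μ B̃^j_{μ:k} = 0, and so is its complex conjugate. -/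
/-!
`(1+m)`-dimensional Minkowski space `M^{1+m}` is modeled as `Fin (m+1) → ℝ` with
coordinates `x 0, x 1, ..., x m` and metric `η = diag(1, -1, ..., -1)`.
`pd μ f` is the partial derivative `∂_μ f`, `pdM` its entrywise matrix version,
`boxS`/`boxM` the d'Alembertian `□ = ∂_0² - Σ_{k=1}^m ∂_k²`, and contractions over a
repeated index `μ` are written as `∑ μ, eta μ * ⋯` (resp. `eta μ • ⋯`).
-/

noncomputable section
open Matrix
open scoped Kronecker

/-- The function is differentiable at the point, with the given partial derivative. -/
def HasPd {m : ℕ} (μ : Fin (m + 1)) (f : Spacetime m → ℂ) (f' : ℂ) (x : Spacetime m) : Prop :=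
  DifferentiableAt ℝ f x ∧ pd μ f x = f'

theorem HasPd.mul {m : ℕ} {μ : Fin (m + 1)} {f g : Spacetime m → ℂ} {f' g' : ℂ}
    {x : Spacetime m} (hf : HasPd μ f f' x) (hg : HasPd μ g g' x) :
    HasPd μ (fun y => f y * g y) (f' * g x + f x * g') x := by
  refine ⟨hf.1.mul hg.1, ?_⟩
  rw [← hf.2, ← hg.2]
  simp only [pd]
  rw [fderiv_fun_mul hf.1 hg.1]
  simp
  ring

theorem HasPd.sub {m : ℕ} {μ : Fin (m + 1)} {f g : Spacetime m → ℂ} {f' g' : ℂ}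
    {x : Spacetime m} (hf : HasPd μ f f' x) (hg : HasPd μ g g' x) :
    HasPd μ (fun y => f y - g y) (f' - g') x := by
  refine ⟨hf.1.sub hg.1, ?_⟩
  rw [← hf.2, ← hg.2]
  simp only [pd]
  rw [fderiv_fun_sub hf.1 hg.1]
  simp

theorem HasPd.const_add {m : ℕ} {μ : Fin (m + 1)} {f : Spacetime m → ℂ} {f' : ℂ}
    {x : Spacetime m} (c : ℂ) (hf : HasPd μ f f' x) :
    HasPd μ (fun y => c + f y) f' x := by
  refine ⟨hf.1.const_add c, ?_⟩
  rw [← hf.2]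
  simp only [pd]
  rw [fderiv_const_add]

theorem HasPd.const_mul {m : ℕ} {μ : Fin (m + 1)} {f : Spacetime m → ℂ} {f' : ℂ}
    {x : Spacetime m} (c : ℂ) (hf : HasPd μ f f' x) :
    HasPd μ (fun y => c * f y) (c * f') x := by
  refine ⟨hf.1.const_mul c, ?_⟩
  rw [← hf.2]
  simp only [pd]
  rw [fderiv_const_mul hf.1]
  simp

theorem HasPd.comp {m : ℕ} {μ : Fin (m + 1)} {f : Spacetime m → ℂ} {f' : ℂ}
    {x : Spacetime m} {g : ℂ → ℂ} {g' : ℂ} (hg : HasDerivAt g g' (f x)) (hf : HasPd μ f f' x) :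
    HasPd μ (fun y => g (f y)) (g' * f') x := by
  have h := hg.comp_hasFDerivAt_of_eq x hf.1.hasFDerivAt rfl
  refine ⟨h.differentiableAt, ?_⟩
  rw [← hf.2]
  have := h.fderiv
  simp only [pd]
  change fderiv ℝ (g ∘ f) x _ = _
  rw [this]
  simp

theorem HasPd.pow {m : ℕ} {μ : Fin (m + 1)} {f : Spacetime m → ℂ} {f' : ℂ}
    {x : Spacetime m} (n : ℕ) (hf : HasPd μ f f' x) :
    HasPd μ (fun y => f y ^ n) (n * f x ^ (n - 1) * f') x :=
  HasPd.comp (hasDerivAt_pow n (f x)) hf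

theorem HasPd.inv {m : ℕ} {μ : Fin (m + 1)} {f : Spacetime m → ℂ} {f' : ℂ}
    {x : Spacetime m} (h0 : f x ≠ 0) (hf : HasPd μ f f' x) :
    HasPd μ (fun y => (f y)⁻¹) (-(f x ^ 2)⁻¹ * f') x :=
  HasPd.comp (hasDerivAt_inv h0) hf

theorem pd_conj {m : ℕ} (μ : Fin (m + 1)) (f : Spacetime m → ℂ) (x : Spacetime m) :
    pd μ (fun y => (starRingEnd ℂ) (f y)) x = (starRingEnd ℂ) (pd μ f x) := by
  have := Complex.conjCLE.comp_fderiv (f := f) (x := x)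
  simp only [pd]
  change fderiv ℝ (Complex.conjCLE ∘ f) x _ = _
  rw [this]
  simp

theorem conj_eta {m : ℕ} (μ : Fin (m + 1)) : (starRingEnd ℂ) (eta μ) = eta μ := by
  unfold eta; split_ifs <;> simp

theorem differentiable_pd {m : ℕ} (μ : Fin (m + 1)) (u : Spacetime m → ℂ)
    (hu : ContDiff ℝ (⊤ : ℕ∞) u) : Differentiable ℝ (pd μ u) := by
  have h : Differentiable ℝ (fderiv ℝ u) :=
    (hu.fderiv_right (m := 1) (by norm_cast)).differentiable (by simp)
  intro x
  exact (h x).clm_apply (differentiableAt_const _)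

theorem current_pd {m : ℕ} (u v : Spacetime m → ℂ) (μ : Fin (m + 1)) (x : Spacetime m)
    (hu : DifferentiableAt ℝ u x) (hv : DifferentiableAt ℝ v x)
    (hpu : DifferentiableAt ℝ (pd μ u) x) (hpv : DifferentiableAt ℝ (pd μ v) x)
    (hD : 1 + u x * v x ≠ 0) (j k : ℕ) :
    ∃ a b c d : ℂ, a = ((1 + u x * v x) ^ (j + 1))⁻¹ *
        (j * v x * u x ^ k - k * (1 + u x * v x) * u x ^ (k - 1)) ∧
      b = - ((1 + u x * v x) ^ (j + 1))⁻¹ * (j * u x * u x ^ k) ∧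
      c = -(j + 1) * v x * (j * v x * u x ^ k - k * (1 + u x * v x) * u x ^ (k - 1)) *
          ((1 + u x * v x) ^ (j + 2))⁻¹ + ((1 + u x * v x) ^ (j + 1))⁻¹ *
          (j * v x * k * u x ^ (k - 1) - k * v x * u x ^ (k - 1)
            - k * (1 + u x * v x) * ((k - 1 : ℕ) * u x ^ (k - 1 - 1))) ∧
      d = (j + 1) * j * u x ^ 2 * u x ^ k * ((1 + u x * v x) ^ (j + 2))⁻¹ ∧
      pd μ (fun y => ((1 + u y * v y) ^ (j + 1))⁻¹ *
          ((j : ℂ) * (pd μ u y * v y - u y * pd μ v y) * u y ^ k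
            - (k : ℂ) * (1 + u y * v y) * u y ^ (k - 1) * pd μ u y)) x
      = a * pd μ (pd μ u) x + b * pd μ (pd μ v) x + c * (pd μ u x * pd μ u x)
        + d * (pd μ v x * pd μ v x) := by
  refine ⟨_, _, _, _, rfl, rfl, rfl, rfl, ?_⟩
  have h1 : HasPd μ u (pd μ u x) x := ⟨hu, rfl⟩
  have h2 : HasPd μ v (pd μ v x) x := ⟨hv, rfl⟩
  have h3 : HasPd μ (pd μ u) (pd μ (pd μ u) x) x := ⟨hpu, rfl⟩
  have h4 : HasPd μ (pd μ v) (pd μ (pd μ v) x) x := ⟨hpv, rfl⟩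
  have hDD := (h1.mul h2).const_add 1
  have key := (((hDD.pow (j + 1)).inv (pow_ne_zero _ hD)).mul
    (((((h3.mul h2).sub (h1.mul h4)).const_mul (j : ℂ)).mul (h1.pow k)).sub
      (((hDD.const_mul (k : ℂ)).mul (h1.pow (k - 1))).mul h3))).2
  rw [key]
  generalize pd μ (pd μ u) x = p'
  generalize pd μ (pd μ v) x = q'
  generalize pd μ u x = p
  generalize pd μ v x = q
  generalize u x = U at *
  generalize v x = V at *
  have hk : (k : ℂ) * U ^ k = k * (U * U ^ (k - 1)) := by
    rcases k with _ | l
    · simp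
    · simp [pow_succ']
  generalize U ^ (k - 1 - 1) = r at *
  generalize U ^ (k - 1) = w at *
  generalize U ^ k = W at *
  push_cast
  try rw [Nat.add_sub_cancel]
  generalize hDe : 1 + U * V = D at *
  have hP : D ^ j ≠ 0 := pow_ne_zero _ hD
  rw [pow_succ D j, pow_add D j 2]
  generalize D ^ j = P at *
  field_simp
  ring

/-- If a smooth `u : M^{1+m} → ℂ` satisfies `□u = 0` and
`∂^μu ∂_μu = 0`, then for all integers `j ≥ 1` and `0 ≤ k ≤ j` the current
`B̃^j_{μ:k} = (1+|u|²)^{-(j+1)} { j(∂_μu·ū - u·∂_μū)·u^k - k(1+|u|²)·u^{k-1}·∂_μu }`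
is conserved, and so is its complex conjugate.  (For `k = 0` the second term carries the
coefficient `k = 0`, implementing the convention `u⁻¹∂_μu := 0`.) -/
theorem statement1 {m : ℕ} (u : Spacetime m → ℂ)
    (hu : ContDiff ℝ (⊤ : ℕ∞) u)
    (hbox : ∀ x, boxS u x = 0)
    (hnull : ∀ x, ∑ μ, eta μ * pd μ u x * pd μ u x = 0)
    (j k : ℕ) (hj : 1 ≤ j) (hk : k ≤ j) :
    (∀ x, ∑ μ, eta μ * pd μ (fun y =>
        ((1 + u y * (starRingEnd ℂ) (u y)) ^ (j + 1))⁻¹ *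
          ((j : ℂ) * (pd μ u y * (starRingEnd ℂ) (u y)
              - u y * pd μ (fun z => (starRingEnd ℂ) (u z)) y) * u y ^ k
            - (k : ℂ) * (1 + u y * (starRingEnd ℂ) (u y)) * u y ^ (k - 1) * pd μ u y)) x
      = 0)
    ∧
    (∀ x, ∑ μ, eta μ * pd μ (fun y => (starRingEnd ℂ)
        (((1 + u y * (starRingEnd ℂ) (u y)) ^ (j + 1))⁻¹ *
          ((j : ℂ) * (pd μ u y * (starRingEnd ℂ) (u y)
              - u y * pd μ (fun z => (starRingEnd ℂ) (u z)) y) * u y ^ k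
            - (k : ℂ) * (1 + u y * (starRingEnd ℂ) (u y)) * u y ^ (k - 1) * pd μ u y))) x
      = 0) := by
  have hD : ∀ x, 1 + u x * (starRingEnd ℂ) (u x) ≠ 0 := by
    intro x h
    rw [Complex.mul_conj] at h
    have h' : (1 + Complex.normSq (u x) : ℝ) = 0 := by exact_mod_cast h
    linarith [Complex.normSq_nonneg (u x)]
  have hv : ContDiff ℝ (⊤ : ℕ∞) (fun z => (starRingEnd ℂ) (u z)) :=
    Complex.conjCLE.contDiff.comp hu
  have hpv : ∀ μ, pd μ (fun z => (starRingEnd ℂ) (u z)) =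
      fun z => (starRingEnd ℂ) (pd μ u z) := fun μ => funext fun z => pd_conj μ u z
  have first : ∀ x, ∑ μ, eta μ * pd μ (fun y =>
        ((1 + u y * (starRingEnd ℂ) (u y)) ^ (j + 1))⁻¹ *
          ((j : ℂ) * (pd μ u y * (starRingEnd ℂ) (u y)
              - u y * pd μ (fun z => (starRingEnd ℂ) (u z)) y) * u y ^ k
            - (k : ℂ) * (1 + u y * (starRingEnd ℂ) (u y)) * u y ^ (k - 1) * pd μ u y)) x
      = 0 := by
    intro x
    have hboxv : ∑ μ, eta μ * pd μ (pd μ (fun z => (starRingEnd ℂ) (u z))) x = 0 := by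
      have := congrArg (starRingEnd ℂ) (hbox x)
      simpa [boxS, map_sum, conj_eta, hpv, pd_conj] using this
    have hnullv : ∑ μ, eta μ * pd μ (fun z => (starRingEnd ℂ) (u z)) x *
        pd μ (fun z => (starRingEnd ℂ) (u z)) x = 0 := by
      have := congrArg (starRingEnd ℂ) (hnull x)
      simpa [map_sum, conj_eta, hpv] using this
    have hb := hbox x
    have hn := hnull x
    simp only [boxS] at hb
    have hc : ∀ μ, _ := fun μ => current_pd u (fun z => (starRingEnd ℂ) (u z)) μ x
      (hu.differentiable (by simp) x) (hv.differentiable (by simp) x)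
      (differentiable_pd μ _ hu x) (differentiable_pd μ _ hv x) (hD x) j k
    obtain ⟨a, b, c, d, ha, hb', hc', hd, -⟩ := hc 0
    have hall : ∀ μ, pd μ (fun y =>
        ((1 + u y * (starRingEnd ℂ) (u y)) ^ (j + 1))⁻¹ *
          ((j : ℂ) * (pd μ u y * (starRingEnd ℂ) (u y)
              - u y * pd μ (fun z => (starRingEnd ℂ) (u z)) y) * u y ^ k
            - (k : ℂ) * (1 + u y * (starRingEnd ℂ) (u y)) * u y ^ (k - 1) * pd μ u y)) x
        = a * pd μ (pd μ u) x
        + b * pd μ (pd μ (fun z => (starRingEnd ℂ) (u z))) x + c * (pd μ u x * pd μ u x)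
        + d * (pd μ (fun z => (starRingEnd ℂ) (u z)) x *
          pd μ (fun z => (starRingEnd ℂ) (u z)) x) := by
      intro μ
      obtain ⟨a1, b1, c1, d1, ha1, hb1, hc1, hd1, h⟩ := hc μ
      rw [← ha] at ha1
      rw [← hb'] at hb1
      rw [← hc'] at hc1
      rw [← hd] at hd1
      rw [ha1, hb1, hc1, hd1] at h
      exact h
    rw [Finset.sum_congr rfl fun μ _ => congrArg (eta μ * ·) (hall μ)]
    have e : ∀ A B C E : Fin (m + 1) → ℂ, ∑ μ, eta μ * (a * A μ + b * B μ + c * (C μ * C μ)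
        + d * (E μ * E μ)) = a * ∑ μ, eta μ * A μ + b * ∑ μ, eta μ * B μ
        + c * ∑ μ, eta μ * C μ * C μ + d * ∑ μ, eta μ * E μ * E μ := by
      intro A B C E
      simp only [Finset.mul_sum, ← Finset.sum_add_distrib]
      exact Finset.sum_congr rfl fun μ _ => by ring
    refine (e _ _ _ _).trans ?_
    rw [hb, hboxv, hn, hnullv]
    simp
  refine ⟨first, fun x => ?_⟩
  have := congrArg (starRingEnd ℂ) (first x)
  rw [map_sum, map_zero] at this
  rw [← this]
  refine Finset.sum_congr rfl fun μ _ => ?_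
  rw [pd_conj, map_mul, conj_eta]
end
end

section
/- Fix 1 ≤ n < N and a constant unitary matrix U ∈ U(N). Let Z : M^{1+m} → M(N−n,n;ℂ) be smooth, with components z_{ij} (1 ≤ i ≤ N−n, 1 ≤ j ≤ n), and set P := U P_0(Z) U†. Then P satisfies the submodel equations [P, □P] = 0 and [P, ∂_μP] ⊗ ∂^μP + ∂^μP ⊗ [P, ∂_μP] = 0 if and only if □Z = 0 and ∂^μZ ⊗ ∂_μZ = 0, equivalently, if and only if ∂^μ∂_μ z_{ij} = 0 and ∂^μz_{ij} ∂_μz_{kl} = 0 for all 1 ≤ i,k ≤ N−n and 1 ≤ j,l ≤ n. -/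
/-!
`(1+m)`-dimensional Minkowski space `M^{1+m}` is modeled as `Fin (m+1) → ℝ` with
coordinates `x 0, x 1, ..., x m` and metric `η = diag(1, -1, ..., -1)`.
`pd μ f` is the partial derivative `∂_μ f`, `pdM` its entrywise matrix version,
`boxS`/`boxM` the d'Alembertian `□ = ∂_0² - Σ_{k=1}^m ∂_k²`, and contractions over a
repeated index `μ` are written as `∑ μ, eta μ * ⋯` (resp. `eta μ • ⋯`).
-/

noncomputable section
open Matrix
open scoped Kronecker

/-- The block matrix `V(Z) = [[I, -Z†],[Z, I]]` on `ℂ^n ⊕ ℂ^p`. -/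
def Vmat {n p : ℕ} (Z : Matrix (Fin p) (Fin n) ℂ) :
    Matrix (Fin n ⊕ Fin p) (Fin n ⊕ Fin p) ℂ :=
  Matrix.fromBlocks 1 (-Zᴴ) Z 1

/-- The block matrix `W(Z) = [[I, Z†],[-Z, I]]` on `ℂ^n ⊕ ℂ^p`. -/
def Wmat {n p : ℕ} (Z : Matrix (Fin p) (Fin n) ℂ) :
    Matrix (Fin n ⊕ Fin p) (Fin n ⊕ Fin p) ℂ :=
  Matrix.fromBlocks 1 Zᴴ (-Z) 1

/-- The projector `P₀(Z) = V(Z) · diag(I_n, 0_p) · V(Z)⁻¹`. -/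
def P0 {n p : ℕ} (Z : Matrix (Fin p) (Fin n) ℂ) :
    Matrix (Fin n ⊕ Fin p) (Fin n ⊕ Fin p) ℂ :=
  Vmat Z * Matrix.fromBlocks 1 0 0 0 * (Vmat Z)⁻¹

def SM {m : ℕ} {ι κ : Type*} (A : Spacetime m → Matrix ι κ ℂ) : Prop :=
  ∀ i j, ContDiff ℝ (⊤ : ℕ∞) fun x => A x i j

theorem SM.mul {m : ℕ} {ι κ l : Type*} [Fintype κ] {A : Spacetime m → Matrix ι κ ℂ}
    {B : Spacetime m → Matrix κ l ℂ} (hA : SM A) (hB : SM B) : SM (fun x => A x * B x) := by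
  intro i j
  simp only [Matrix.mul_apply]
  exact ContDiff.sum fun k _ => (hA i k).mul (hB k j)

theorem SM.const {m : ℕ} {ι κ : Type*} (C : Matrix ι κ ℂ) :
    SM (fun _ : Spacetime m => C) := fun _ _ => contDiff_const

theorem SM.conjT {m : ℕ} {ι κ : Type*} {A : Spacetime m → Matrix ι κ ℂ} (hA : SM A) :
    SM (fun x => (A x)ᴴ) := by
  intro i j
  exact (Complex.conjCLE.contDiff (n := (⊤ : ℕ∞))).comp (hA j i)

theorem SM.neg {m : ℕ} {ι κ : Type*} {A : Spacetime m → Matrix ι κ ℂ} (hA : SM A) :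
    SM (fun x => - (A x)) := fun i j => (hA i j).neg

theorem SM.blocks {m : ℕ} {a b c d : Type*} {A : Spacetime m → Matrix a c ℂ}
    {B : Spacetime m → Matrix a d ℂ} {C : Spacetime m → Matrix b c ℂ}
    {D : Spacetime m → Matrix b d ℂ} (hA : SM A) (hB : SM B) (hC : SM C) (hD : SM D) :
    SM (fun x => Matrix.fromBlocks (A x) (B x) (C x) (D x)) := by
  rintro (i | i) (j | j)
  · exact hA i j
  · exact hB i j
  · exact hC i j
  · exact hD i j

theorem SM.det {m : ℕ} {ι : Type*} [Fintype ι] [DecidableEq ι]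
    {A : Spacetime m → Matrix ι ι ℂ} (hA : SM A) :
    ContDiff ℝ (⊤ : ℕ∞) (fun x => (A x).det) := by
  simp only [Matrix.det_apply]
  refine ContDiff.sum fun σ _ => ?_
  exact ContDiff.const_smul _ (contDiff_prod fun i _ => hA _ _)

theorem SM.inv {m : ℕ} {ι : Type*} [Fintype ι] [DecidableEq ι]
    {A : Spacetime m → Matrix ι ι ℂ} (hA : SM A) (h : ∀ x, (A x).det ≠ 0) :
    SM (fun x => (A x)⁻¹) := by
  intro i j
  simp only [Matrix.inv_def, Ring.inverse_eq_inv', Matrix.smul_apply, smul_eq_mul,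
    Matrix.adjugate_apply]
  refine ContDiff.mul (ContDiff.inv hA.det h) ?_
  refine SM.det ?_
  intro k l
  by_cases hk : k = j
  · subst hk
    simpa using contDiff_const
  · simpa [Matrix.updateRow_ne hk] using hA k l

theorem SM.pdM {m : ℕ} {ι κ : Type*} {A : Spacetime m → Matrix ι κ ℂ} (hA : SM A)
    (μ : Fin (m + 1)) : SM (pdM μ A) := by
  intro i j
  have h := (hA i j).fderiv_right (m := (⊤ : ℕ∞)) (by simp)
  exact h.clm_apply contDiff_const

theorem pdM_mul {m : ℕ} {ι κ l : Type*} [Fintype κ] {A : Spacetime m → Matrix ι κ ℂ}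
    {B : Spacetime m → Matrix κ l ℂ} (hA : SM A) (hB : SM B) (μ : Fin (m + 1)) :
    pdM μ (fun x => A x * B x) = fun x => pdM μ A x * B x + A x * pdM μ B x := by
  funext x
  ext i j
  have dA : ∀ i j, DifferentiableAt ℝ (fun x => A x i j) x := fun i j =>
    ((hA i j).differentiable (by simp)) x
  have dB : ∀ i j, DifferentiableAt ℝ (fun x => B x i j) x := fun i j =>
    ((hB i j).differentiable (by simp)) x
  simp only [pdM, pd, Matrix.of_apply, Matrix.add_apply, Matrix.mul_apply]
  rw [fderiv_fun_sum (A := fun k y => A y i k * B y k j) (fun k _ => (dA i k).mul (dB k j))]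
  rw [← Finset.sum_add_distrib, ContinuousLinearMap.sum_apply]
  refine Finset.sum_congr rfl fun k _ => ?_
  rw [fderiv_fun_mul (dA i k) (dB k j)]
  simp
  ring

theorem pdM_add {m : ℕ} {ι κ : Type*} {A B : Spacetime m → Matrix ι κ ℂ}
    (hA : SM A) (hB : SM B) (μ : Fin (m + 1)) :
    pdM μ (fun x => A x + B x) = fun x => pdM μ A x + pdM μ B x := by
  funext x
  ext i j
  simp only [pdM, pd, Matrix.of_apply, Matrix.add_apply]
  rw [fderiv_fun_add ((hA i j).differentiable (by simp) x) ((hB i j).differentiable (by simp) x)]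
  rfl

theorem pdM_const {m : ℕ} {ι κ : Type*} (C : Matrix ι κ ℂ) (μ : Fin (m + 1)) :
    pdM μ (fun _ : Spacetime m => C) = fun _ => 0 := by
  funext x
  ext i j
  simp [pdM, pd]

theorem pdM_neg {m : ℕ} {ι κ : Type*} (A : Spacetime m → Matrix ι κ ℂ) (μ : Fin (m + 1)) :
    pdM μ (fun x => - A x) = fun x => - pdM μ A x := by
  funext x
  ext i j
  simp [pdM, pd]

theorem pdM_conjT {m : ℕ} {ι κ : Type*} (A : Spacetime m → Matrix ι κ ℂ) (μ : Fin (m + 1)) :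
    pdM μ (fun x => (A x)ᴴ) = fun x => (pdM μ A x)ᴴ := by
  funext x
  ext i j
  simp only [pdM, pd, Matrix.of_apply, Matrix.conjTranspose_apply]
  exact congrArg (fun L => L (Pi.single μ 1)) (Complex.conjCLE.comp_fderiv (f := fun y => A y j i) (x := x))

theorem pdM_blocks {m : ℕ} {a b c d : Type*} (A : Spacetime m → Matrix a c ℂ)
    (B : Spacetime m → Matrix a d ℂ) (C : Spacetime m → Matrix b c ℂ)
    (D : Spacetime m → Matrix b d ℂ) (μ : Fin (m + 1)) :
    pdM μ (fun x => Matrix.fromBlocks (A x) (B x) (C x) (D x)) =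
      fun x => Matrix.fromBlocks (pdM μ A x) (pdM μ B x) (pdM μ C x) (pdM μ D x) := by
  funext x
  ext i j
  rcases i with i | i <;> rcases j with j | j <;> rfl

theorem pdM_Vmat {m n p : ℕ} (Z : Spacetime m → Matrix (Fin p) (Fin n) ℂ) (μ : Fin (m + 1)) :
    pdM μ (fun x => Vmat (Z x)) =
      fun x => Matrix.fromBlocks 0 (-(pdM μ Z x)ᴴ) (pdM μ Z x) 0 := by
  unfold Vmat
  rw [pdM_blocks, pdM_neg, pdM_conjT, pdM_const, pdM_const]

theorem pdM_pdM_Vmat {m n p : ℕ} (Z : Spacetime m → Matrix (Fin p) (Fin n) ℂ)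
    (μ : Fin (m + 1)) :
    pdM μ (pdM μ (fun x => Vmat (Z x))) =
      fun x => Matrix.fromBlocks 0 (-(pdM μ (pdM μ Z) x)ᴴ) (pdM μ (pdM μ Z) x) 0 := by
  rw [pdM_Vmat, pdM_blocks, pdM_neg, pdM_conjT, pdM_const, pdM_const]

/-- The diagonal block matrix `V† V`. -/
def Dmat {n p : ℕ} (Z : Matrix (Fin p) (Fin n) ℂ) :
    Matrix (Fin n ⊕ Fin p) (Fin n ⊕ Fin p) ℂ :=
  Matrix.fromBlocks (1 + Zᴴ * Z) 0 0 (1 + Z * Zᴴ)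

theorem Vmat_conjT_mul {n p : ℕ} (Z : Matrix (Fin p) (Fin n) ℂ) :
    (Vmat Z)ᴴ * Vmat Z = Dmat Z := by
  simp [Vmat, Dmat, Matrix.fromBlocks_conjTranspose, Matrix.fromBlocks_multiply, add_comm]

open scoped ComplexOrder in
theorem det1 {n p : ℕ} (Z : Matrix (Fin p) (Fin n) ℂ) : (1 + Zᴴ * Z).det ≠ 0 := by
  have : (1 + Zᴴ * Z).PosDef :=
    Matrix.PosDef.one.add_posSemidef (Matrix.posSemidef_conjTranspose_mul_self Z)
  exact this.det_pos.ne'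

theorem det2 {n p : ℕ} (Z : Matrix (Fin p) (Fin n) ℂ) : (1 + Z * Zᴴ).det ≠ 0 := by
  simpa using det1 Zᴴ

theorem detV {n p : ℕ} (Z : Matrix (Fin p) (Fin n) ℂ) : (Vmat Z).det ≠ 0 := by
  intro h
  have := congrArg Matrix.det (Vmat_conjT_mul Z)
  rw [Matrix.det_mul, h, mul_zero, Dmat, Matrix.det_fromBlocks_zero₂₁] at this
  exact mul_ne_zero (det1 Z) (det2 Z) this.symm

theorem eta_star {m : ℕ} (μ : Fin (m + 1)) : star (eta μ) = eta μ := by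
  unfold eta; split <;> simp

theorem sum_sandwich {m : ℕ} {ι κ : Type*} [Fintype ι] [Fintype κ]
    (z : Fin (m + 1) → Matrix ι κ ℂ)
    (h : ∀ i k j l, ∑ μ, eta μ * z μ i j * z μ k l = 0) (M : Matrix κ ι ℂ) :
    ∑ μ, eta μ • (z μ * M * z μ) = 0 := by
  ext i l
  simp only [Matrix.sum_apply, Matrix.smul_apply, Matrix.mul_apply, smul_eq_mul,
    Finset.mul_sum, Finset.sum_mul, Matrix.zero_apply]
  rw [Finset.sum_comm]
  refine Finset.sum_eq_zero fun k _ => ?_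
  rw [Finset.sum_comm]
  refine Finset.sum_eq_zero fun j _ => ?_
  have := congrArg (· * M j k) (h i k j l)
  simp only [Finset.sum_mul, zero_mul] at this
  rw [← this]
  refine Finset.sum_congr rfl fun μ _ => ?_
  ring

theorem kron_alg {m n p : ℕ} (z : Fin (m + 1) → Matrix (Fin p) (Fin n) ℂ) :
    (∑ μ, eta μ • ((Matrix.fromBlocks 0 (z μ)ᴴ (-z μ) 0) ⊗ₖ (Matrix.fromBlocks 0 (z μ)ᴴ (z μ) 0)
      + (Matrix.fromBlocks 0 (z μ)ᴴ (z μ) 0) ⊗ₖ (Matrix.fromBlocks 0 (z μ)ᴴ (-z μ) 0)) = 0) ↔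
    ∀ i k j l, ∑ μ, eta μ * z μ i j * z μ k l = 0 := by
  constructor
  · intro h i k j l
    have := congrFun (congrFun h (Sum.inr i, Sum.inr k)) (Sum.inl j, Sum.inl l)
    simp only [Matrix.sum_apply, Matrix.smul_apply, Matrix.add_apply, Matrix.kroneckerMap_apply,
      Matrix.fromBlocks_apply₂₁, Matrix.neg_apply, smul_eq_mul, Matrix.zero_apply] at this
    have h2 : (-2 : ℂ) * ∑ μ, eta μ * z μ i j * z μ k l = 0 := by
      rw [← this, Finset.mul_sum]
      refine Finset.sum_congr rfl fun μ _ => ?_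
      ring
    simpa using h2
  · intro h
    have hs : ∀ i k j l, ∑ μ, eta μ * star (z μ i j) * star (z μ k l) = 0 := by
      intro i k j l
      have := congrArg star (h i k j l)
      rw [star_sum, star_zero] at this
      rw [← this]
      refine Finset.sum_congr rfl fun μ _ => ?_
      rw [star_mul', star_mul', eta_star]
    ext ⟨i, k⟩ ⟨j, l⟩
    simp only [Matrix.sum_apply, Matrix.smul_apply, Matrix.add_apply, Matrix.kroneckerMap_apply,
       smul_eq_mul, Matrix.zero_apply]
    rcases i with i | i <;> rcases j with j | j <;> rcases k with k | k <;> rcases l with l | l <;>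
      simp only [Matrix.fromBlocks_apply₂₁, Matrix.fromBlocks_apply₁₂, Matrix.fromBlocks_apply₁₁,
        Matrix.fromBlocks_apply₂₂, Matrix.neg_apply, Matrix.zero_apply, mul_zero, zero_mul, add_zero,
        Finset.sum_const_zero, Matrix.conjTranspose_apply]
    · have h2 := congrArg (2 * ·) (hs j l i k)
      simp only [mul_zero, Finset.mul_sum] at h2
      rw [← h2]
      exact Finset.sum_congr rfl fun μ _ => by ring
    · exact Finset.sum_eq_zero fun μ _ => by ring
    · exact Finset.sum_eq_zero fun μ _ => by ring
    · have h2 := congrArg (-2 * ·) (h i k j l)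
      simp only [mul_zero, Finset.mul_sum] at h2
      rw [← h2]
      exact Finset.sum_congr rfl fun μ _ => by ring

theorem conj_zero_iff {ι : Type*} [Fintype ι] [DecidableEq ι] {L L' Y Y' : Matrix ι ι ℂ}
    (hL : L' * L = 1) (hY : Y * Y' = 1) (M : Matrix ι ι ℂ) : L * M * Y = 0 ↔ M = 0 := by
  constructor
  · intro h
    calc M = (L' * L) * M * (Y * Y') := by rw [hL, hY]; simp
      _ = L' * (L * M * Y) * Y' := by simp only [Matrix.mul_assoc]
      _ = 0 := by rw [h]; simp
  · rintro rfl; simp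

theorem kron_conj {m : ℕ} {ι : Type*} [Fintype ι] [DecidableEq ι] {L L' Y Y' : Matrix ι ι ℂ}
    (hL : L' * L = 1) (hY : Y * Y' = 1) (G F : Fin (m + 1) → Matrix ι ι ℂ) :
    (∑ μ, eta μ • ((L * G μ * Y) ⊗ₖ (L * F μ * Y) + (L * F μ * Y) ⊗ₖ (L * G μ * Y)) = 0) ↔
    ∑ μ, eta μ • (G μ ⊗ₖ F μ + F μ ⊗ₖ G μ) = 0 := by
  have e : (∑ μ, eta μ • ((L * G μ * Y) ⊗ₖ (L * F μ * Y) + (L * F μ * Y) ⊗ₖ (L * G μ * Y))) =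
      (L ⊗ₖ L) * (∑ μ, eta μ • (G μ ⊗ₖ F μ + F μ ⊗ₖ G μ)) * (Y ⊗ₖ Y) := by
    simp only [Matrix.mul_kronecker_mul, Finset.mul_sum, Finset.sum_mul, Matrix.mul_smul,
      Matrix.smul_mul, Matrix.mul_add, Matrix.add_mul]
  rw [e]
  refine conj_zero_iff (L' := L' ⊗ₖ L') (Y' := Y' ⊗ₖ Y') ?_ ?_ _
  · rw [← Matrix.mul_kronecker_mul, hL, Matrix.one_kronecker_one]
  · rw [← Matrix.mul_kronecker_mul, hY, Matrix.one_kronecker_one]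

theorem fromBlocks_sub_aux {a b c d : Type*} (A A' : Matrix a c ℂ)
    (B B' : Matrix a d ℂ) (C C' : Matrix b c ℂ) (D D' : Matrix b d ℂ) :
    Matrix.fromBlocks A B C D - Matrix.fromBlocks A' B' C' D' =
      Matrix.fromBlocks (A - A') (B - B') (C - C') (D - D') := by
  ext i j
  rcases i with i | i <;> rcases j with j | j <;> rfl

/-- Components of the d'Alembertian part. -/
theorem box_alg {m n p : ℕ} (z : Fin (m + 1) → Matrix (Fin p) (Fin n) ℂ)
    (h : ∀ i k j l, ∑ μ, eta μ * z μ i j * z μ k l = 0)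
    (Z b : Matrix (Fin p) (Fin n) ℂ) (d1 : Matrix (Fin n) (Fin n) ℂ)
    (d2 : Matrix (Fin p) (Fin p) ℂ)
    (E KK : Matrix (Fin n ⊕ Fin p) (Fin n ⊕ Fin p) ℂ)
    (hE : E = Matrix.fromBlocks 1 0 0 0)
    (hK : KK = Matrix.fromBlocks 0 bᴴ b 0 - (2 : ℂ) • ∑ μ, eta μ •
      (Matrix.fromBlocks 0 (z μ)ᴴ (z μ) 0 * Matrix.fromBlocks d1 0 0 d2 *
        Matrix.fromBlocks (Zᴴ * z μ) (-(z μ)ᴴ) (z μ) (Z * (z μ)ᴴ))) :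
    E * KK - KK * E = 0 ↔ b = 0 := by
  have h1 := sum_sandwich z h (d1 * Zᴴ)
  have hs : ∀ i k j l, ∑ μ, eta μ * (z μ)ᴴ i j * (z μ)ᴴ k l = 0 := by
    intro i k j l
    have := congrArg star (h j l i k)
    rw [star_sum, star_zero] at this
    rw [← this]
    refine Finset.sum_congr rfl fun μ _ => ?_
    rw [star_mul', star_mul', eta_star]
    rfl
  have h2 := sum_sandwich (fun μ => (z μ)ᴴ) hs (d2 * Z)
  have hsum : ∃ A B, ∑ μ, eta μ •
      (Matrix.fromBlocks 0 (z μ)ᴴ (z μ) 0 * Matrix.fromBlocks d1 0 0 d2 *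
        Matrix.fromBlocks (Zᴴ * z μ) (-(z μ)ᴴ) (z μ) (Z * (z μ)ᴴ)) =
      Matrix.fromBlocks A 0 0 B := by
    set S := ∑ μ, eta μ •
      (Matrix.fromBlocks 0 (z μ)ᴴ (z μ) 0 * Matrix.fromBlocks d1 0 0 d2 *
        Matrix.fromBlocks (Zᴴ * z μ) (-(z μ)ᴴ) (z μ) (Z * (z μ)ᴴ)) with hS
    refine ⟨S.toBlocks₁₁, S.toBlocks₂₂, ?_⟩
    conv_lhs => rw [← Matrix.fromBlocks_toBlocks S]
    congr 1
    · rw [← h2, hS]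
      ext i j
      simp only [Matrix.fromBlocks_multiply, Matrix.toBlocks₁₂, Matrix.of_apply, Matrix.sum_apply,
        Matrix.smul_apply, Matrix.fromBlocks_apply₁₂]
      simp [Matrix.mul_assoc]
    · rw [← h1, hS]
      ext i j
      simp only [Matrix.fromBlocks_multiply, Matrix.toBlocks₂₁, Matrix.of_apply, Matrix.sum_apply,
        Matrix.smul_apply, Matrix.fromBlocks_apply₂₁]
      simp [Matrix.mul_assoc]
  obtain ⟨A, B, hAB⟩ := hsum
  rw [hAB] at hK
  subst hE hK
  rw [Matrix.fromBlocks_smul, fromBlocks_sub_aux, Matrix.fromBlocks_multiply,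
    Matrix.fromBlocks_multiply, fromBlocks_sub_aux]
  constructor
  · intro h
    have := congrArg Matrix.toBlocks₂₁ h
    simp only [Matrix.toBlocks_fromBlocks₂₁] at this
    have t : (0 : Matrix (Fin n ⊕ Fin p) (Fin n ⊕ Fin p) ℂ).toBlocks₂₁ = 0 := rfl
    simpa [t] using this
  · rintro rfl
    simp [Matrix.fromBlocks_zero]

theorem main_point {m n p : ℕ}
    (U : Matrix (Fin n ⊕ Fin p) (Fin n ⊕ Fin p) ℂ)
    (hU : U ∈ Matrix.unitaryGroup (Fin n ⊕ Fin p) ℂ)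
    (Z : Spacetime m → Matrix (Fin p) (Fin n) ℂ)
    (hZ : ∀ i j, ContDiff ℝ (⊤ : ℕ∞) fun x => Z x i j)
    (P : Spacetime m → Matrix (Fin n ⊕ Fin p) (Fin n ⊕ Fin p) ℂ)
    (hP : ∀ x, P x = U * P0 (Z x) * Uᴴ) (x : Spacetime m) :
    ((∑ μ, eta μ •
          ((P x * pdM μ P x - pdM μ P x * P x) ⊗ₖ pdM μ P x
            + pdM μ P x ⊗ₖ (P x * pdM μ P x - pdM μ P x * P x)) = 0) ↔
      ∀ i k j l, ∑ μ, eta μ * pdM μ Z x i j * pdM μ Z x k l = 0) ∧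
    ((∀ i k j l, ∑ μ, eta μ * pdM μ Z x i j * pdM μ Z x k l = 0) →
      ((P x * boxM P x - boxM P x * P x = 0) ↔ boxM Z x = 0)) := by
  have hUU : Uᴴ * U = 1 := Matrix.mem_unitaryGroup_iff'.1 hU
  have hUU' : U * Uᴴ = 1 := Matrix.mem_unitaryGroup_iff.1 hU
  have sV : SM (fun x => Vmat (Z x)) :=
    SM.blocks (SM.const _) (SM.neg (SM.conjT hZ)) hZ (SM.const _)
  have sP : SM P := by
    have : P = fun x => U * P0 (Z x) * Uᴴ := funext hP
    rw [this]
    exact ((SM.const U).mul ((sV.mul (SM.const _)).mul (sV.inv fun x => detV _))).mul (SM.const _)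
  obtain ⟨E, hE⟩ : ∃ E : Matrix (Fin n ⊕ Fin p) (Fin n ⊕ Fin p) ℂ,
    E = Matrix.fromBlocks 1 0 0 0 := ⟨_, rfl⟩
  obtain ⟨X, hX⟩ : ∃ X : Spacetime m → Matrix (Fin n ⊕ Fin p) (Fin n ⊕ Fin p) ℂ,
    X = fun x => U * Vmat (Z x) := ⟨_, rfl⟩
  have sX : SM X := by rw [hX]; exact (SM.const U).mul sV
  have hVi : ∀ x, (Vmat (Z x))⁻¹ * Vmat (Z x) = 1 := fun x =>
    Matrix.nonsing_inv_mul _ (isUnit_iff_ne_zero.2 (detV _))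
  have hVi' : ∀ x, Vmat (Z x) * (Vmat (Z x))⁻¹ = 1 := fun x =>
    Matrix.mul_nonsing_inv _ (isUnit_iff_ne_zero.2 (detV _))
  have hPX : (fun x => P x * X x) = fun x => X x * E := by
    funext y
    rw [hP, hX, P0, hE]
    calc _ = U * Vmat (Z y) * Matrix.fromBlocks 1 0 0 0 * ((Vmat (Z y))⁻¹ * (Uᴴ * U) * Vmat (Z y)) := by
            simp only [Matrix.mul_assoc]
      _ = _ := by rw [hUU, Matrix.mul_one, hVi, Matrix.mul_one]
  have d1 : ∀ μ, (fun x => pdM μ P x * X x + P x * pdM μ X x) = fun x => pdM μ X x * E := by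
    intro μ
    have := congrArg (pdM μ) hPX
    rw [pdM_mul sP sX, pdM_mul sX (SM.const E), pdM_const] at this
    simpa using this
  have d2 : ∀ μ, pdM μ (pdM μ P) x * X x + (2 : ℂ) • (pdM μ P x * pdM μ X x) +
      P x * pdM μ (pdM μ X) x = pdM μ (pdM μ X) x * E := by
    intro μ
    have := congrFun (congrArg (pdM μ) (d1 μ)) x
    rw [pdM_add ((sP.pdM μ).mul sX) (sP.mul (sX.pdM μ)), pdM_mul (sP.pdM μ) sX,
      pdM_mul sP (sX.pdM μ), pdM_mul (sX.pdM μ) (SM.const E), pdM_const] at this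
    simp only [Matrix.mul_zero, add_zero] at this
    rw [← this, two_smul]
    abel
  have d1x : ∀ μ, pdM μ P x * X x + P x * pdM μ X x = pdM μ X x * E := fun μ => congrFun (d1 μ) x
  have dX : ∀ μ, pdM μ X x =
      U * Matrix.fromBlocks 0 (-(pdM μ Z x)ᴴ) (pdM μ Z x) 0 := by
    intro μ
    rw [hX, pdM_mul (SM.const U) sV, pdM_const, pdM_Vmat]
    simp
  have ddX : ∀ μ, pdM μ (pdM μ X) x =
      U * Matrix.fromBlocks 0 (-(pdM μ (pdM μ Z) x)ᴴ) (pdM μ (pdM μ Z) x) 0 := by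
    intro μ
    rw [hX, pdM_mul (SM.const U) sV, pdM_const]
    simp only [Matrix.zero_mul, zero_add]
    rw [pdM_mul (SM.const U) (sV.pdM μ), pdM_const, pdM_pdM_Vmat]
    simp
  have hboxX : boxM X x = U * Matrix.fromBlocks 0 (-(boxM Z x)ᴴ) (boxM Z x) 0 := by
    simp only [boxM]
    simp only [ddX, ← Matrix.mul_smul, ← Matrix.mul_sum]
    congr 1
    ext i j
    rcases i with i | i <;> rcases j with j | j <;>
      simp [Matrix.sum_apply, Matrix.conjTranspose_sum, eta_star, - Complex.star_def]
  have hbox : boxM P x * X x + (2 : ℂ) • (∑ μ, eta μ • (pdM μ P x * pdM μ X x)) + P x * boxM X x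
      = boxM X x * E := by
    simp only [boxM, Finset.sum_mul, Finset.mul_sum, Finset.smul_sum, ← Finset.sum_add_distrib]
    refine Finset.sum_congr rfl fun μ _ => ?_
    rw [Matrix.smul_mul _ _ E, ← d2 μ, Matrix.mul_smul, Matrix.smul_mul, smul_add, smul_add,
      smul_comm (2 : ℂ)]
  -- pointwise data
  obtain ⟨D, hD⟩ : ∃ D, D = Dmat (Z x) := ⟨_, rfl⟩
  obtain ⟨Di, hDi⟩ : ∃ Di : Matrix (Fin n ⊕ Fin p) (Fin n ⊕ Fin p) ℂ,
    Di = Matrix.fromBlocks (1 + (Z x)ᴴ * Z x)⁻¹ 0 0 (1 + Z x * (Z x)ᴴ)⁻¹ := ⟨_, rfl⟩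
  have hDD : Di * D = 1 := by
    rw [hD, hDi, Dmat, Matrix.fromBlocks_multiply]
    simp [Matrix.nonsing_inv_mul _ (isUnit_iff_ne_zero.2 (det1 (Z x))),
      Matrix.nonsing_inv_mul _ (isUnit_iff_ne_zero.2 (det2 (Z x)))]
  have hED : E * Di = Di * E := by
    rw [hE, hDi]; simp [Matrix.fromBlocks_multiply]
  have hXX : (X x)ᴴ * X x = D := by
    rw [hX, hD, ← Vmat_conjT_mul]
    calc _ = (Vmat (Z x))ᴴ * (Uᴴ * U) * Vmat (Z x) := by
            simp only [Matrix.mul_assoc, Matrix.conjTranspose_mul]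
      _ = _ := by rw [hUU, Matrix.mul_one]
  obtain ⟨Y, hY⟩ : ∃ Y, Y = Di * (X x)ᴴ := ⟨_, rfl⟩
  have hYX : Y * X x = 1 := by rw [hY, Matrix.mul_assoc, hXX, hDD]
  have hXY : X x * Y = 1 := mul_eq_one_comm.1 hYX
  have hDD' : D * Di = 1 := mul_eq_one_comm.1 hDD
  obtain ⟨L, hL⟩ : ∃ L, L = X x * Di := ⟨_, rfl⟩
  have hLL : (D * Y) * L = 1 := by
    rw [hL, Matrix.mul_assoc, ← Matrix.mul_assoc Y, hYX, Matrix.one_mul, hDD']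
  have hYL : Y * L = Di := by rw [hL, ← Matrix.mul_assoc, hYX, Matrix.one_mul]
  have hPx : P x = X x * E * Y := by
    have : P x * X x = X x * E := congrFun hPX x
    rw [← this, Matrix.mul_assoc, hXY, Matrix.mul_one]
  obtain ⟨K, hK⟩ : ∃ K : Fin (m + 1) → Matrix (Fin n ⊕ Fin p) (Fin n ⊕ Fin p) ℂ,
    K = fun μ => Matrix.fromBlocks ((Z x)ᴴ * pdM μ Z x) (-(pdM μ Z x)ᴴ) (pdM μ Z x)
      (Z x * (pdM μ Z x)ᴴ) := ⟨_, rfl⟩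
  obtain ⟨KB, hKB⟩ : ∃ KB : Matrix (Fin n ⊕ Fin p) (Fin n ⊕ Fin p) ℂ,
    KB = Matrix.fromBlocks ((Z x)ᴴ * boxM Z x) (-(boxM Z x)ᴴ) (boxM Z x)
      (Z x * (boxM Z x)ᴴ) := ⟨_, rfl⟩
  have gen : ∀ (b : Matrix (Fin p) (Fin n) ℂ), (U * Matrix.fromBlocks 0 (-bᴴ) b 0) =
      L * Matrix.fromBlocks ((Z x)ᴴ * b) (-bᴴ) b (Z x * bᴴ) := by
    intro b
    have e : (X x)ᴴ * (U * Matrix.fromBlocks 0 (-bᴴ) b 0) =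
        Matrix.fromBlocks ((Z x)ᴴ * b) (-bᴴ) b (Z x * bᴴ) := by
      rw [hX]
      calc _ = (Vmat (Z x))ᴴ * (Uᴴ * U) * Matrix.fromBlocks 0 (-bᴴ) b 0 := by
            simp only [Matrix.mul_assoc, Matrix.conjTranspose_mul]
        _ = _ := by
            rw [hUU, Matrix.mul_one]
            simp [Vmat, Matrix.fromBlocks_conjTranspose, Matrix.fromBlocks_multiply]
    rw [← e, hL]
    calc _ = (X x * Y) * (U * Matrix.fromBlocks 0 (-bᴴ) b 0) := by rw [hXY, Matrix.one_mul]
      _ = _ := by rw [hY]; simp only [Matrix.mul_assoc]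
  have hXK : ∀ μ, pdM μ X x = L * K μ := fun μ => by rw [dX, gen, hK]
  have hXKB : boxM X x = L * KB := by rw [hboxX, gen, hKB]
  have hPL : P x * L = L * E := by
    rw [hPx, Matrix.mul_assoc _ Y, hYL, hL, Matrix.mul_assoc, hED, Matrix.mul_assoc]
  obtain ⟨F, hF⟩ : ∃ F : Fin (m + 1) → Matrix (Fin n ⊕ Fin p) (Fin n ⊕ Fin p) ℂ,
    F = fun μ => Matrix.fromBlocks 0 (pdM μ Z x)ᴴ (pdM μ Z x) 0 := ⟨_, rfl⟩
  have genF : ∀ (b : Matrix (Fin p) (Fin n) ℂ),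
      Matrix.fromBlocks ((Z x)ᴴ * b) (-bᴴ) b (Z x * bᴴ) * E -
      E * Matrix.fromBlocks ((Z x)ᴴ * b) (-bᴴ) b (Z x * bᴴ) = Matrix.fromBlocks 0 bᴴ b 0 := by
    intro b
    rw [hE, Matrix.fromBlocks_multiply, Matrix.fromBlocks_multiply, fromBlocks_sub_aux]
    simp
  have cancel : ∀ A B, A * X x = B → A = B * Y := by
    rintro A B rfl
    rw [Matrix.mul_assoc, hXY, Matrix.mul_one]
  have hPF : ∀ μ, pdM μ P x = L * F μ * Y := by
    intro μ
    apply cancel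
    rw [eq_sub_of_add_eq (d1x μ), hXK, ← Matrix.mul_assoc, hPL, Matrix.mul_assoc, Matrix.mul_assoc,
      ← Matrix.mul_sub, hK, hF]
    simp only
    rw [genF]
  have comm : ∀ M, P x * (L * M * Y) - (L * M * Y) * P x = L * (E * M - M * E) * Y := by
    intro M
    have e1 : P x * (L * M * Y) = L * (E * M) * Y := by
      calc _ = (P x * L) * M * Y := by simp only [Matrix.mul_assoc]
        _ = _ := by rw [hPL]; simp only [Matrix.mul_assoc]
    have e2 : (L * M * Y) * P x = L * (M * E) * Y := by
      rw [hPx]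
      calc _ = L * M * (Y * X x) * E * Y := by simp only [Matrix.mul_assoc]
        _ = _ := by rw [hYX, Matrix.mul_one]; simp only [Matrix.mul_assoc]
    rw [e1, e2, Matrix.mul_sub, Matrix.sub_mul]
  have hEF : ∀ μ, E * F μ - F μ * E = Matrix.fromBlocks 0 (pdM μ Z x)ᴴ (-pdM μ Z x) 0 := by
    intro μ
    rw [hE, hF]
    simp only
    rw [Matrix.fromBlocks_multiply, Matrix.fromBlocks_multiply, fromBlocks_sub_aux]
    simp
  constructor
  · simp only [hPF, comm]
    rw [kron_conj hLL hYX]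
    simp only [hEF]
    rw [hF]
    exact kron_alg fun μ => pdM μ Z x
  · intro h
    have hPB : boxM P x = L * (Matrix.fromBlocks 0 (boxM Z x)ᴴ (boxM Z x) 0 -
        (2 : ℂ) • ∑ μ, eta μ • (F μ * Di * K μ)) * Y := by
      apply cancel
      have e : ∑ μ, eta μ • (pdM μ P x * pdM μ X x) = L * ∑ μ, eta μ • (F μ * Di * K μ) := by
        rw [Finset.mul_sum]
        refine Finset.sum_congr rfl fun μ _ => ?_
        rw [Matrix.mul_smul, hPF, hXK, ← hYL]
        simp only [Matrix.mul_assoc]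
      rw [e, hXKB, ← Matrix.mul_assoc, hPL, add_assoc] at hbox
      rw [eq_sub_of_add_eq hbox, ← genF, ← hKB]
      simp only [Matrix.mul_sub, Matrix.mul_smul, Matrix.mul_assoc]
      abel
    rw [hPB, comm, conj_zero_iff hLL hYX]
    refine box_alg (fun μ => pdM μ Z x) h (Z x) (boxM Z x) (1 + (Z x)ᴴ * Z x)⁻¹
      (1 + Z x * (Z x)ᴴ)⁻¹ E _ hE ?_
    rw [hF, hDi, hK]

/-- For `P = U P₀(Z) U†` (with `U` a constant unitary, `n, p ≥ 1`,
`N = n + p`), the submodel equations `[P,□P] = 0` and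
`[P,∂_μP] ⊗ ∂^μP + ∂^μP ⊗ [P,∂_μP] = 0` hold iff `□Z = 0` and `∂^μZ ⊗ ∂_μZ = 0`,
equivalently iff `□z_{ij} = 0` and `∂^μz_{ij} ∂_μz_{kl} = 0` for all components. -/
theorem statement2 {m n p : ℕ} (hn : 0 < n) (hp : 0 < p)
    (U : Matrix (Fin n ⊕ Fin p) (Fin n ⊕ Fin p) ℂ)
    (hU : U ∈ Matrix.unitaryGroup (Fin n ⊕ Fin p) ℂ)
    (Z : Spacetime m → Matrix (Fin p) (Fin n) ℂ)
    (hZ : ∀ i j, ContDiff ℝ (⊤ : ℕ∞) fun x => Z x i j)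
    (P : Spacetime m → Matrix (Fin n ⊕ Fin p) (Fin n ⊕ Fin p) ℂ)
    (hP : ∀ x, P x = U * P0 (Z x) * Uᴴ) :
    (((∀ x, P x * boxM P x - boxM P x * P x = 0) ∧
        (∀ x, ∑ μ, eta μ •
          ((P x * pdM μ P x - pdM μ P x * P x) ⊗ₖ pdM μ P x
            + pdM μ P x ⊗ₖ (P x * pdM μ P x - pdM μ P x * P x)) = 0))
      ↔ ((∀ x, boxM Z x = 0) ∧
          (∀ x, ∑ μ, eta μ • (pdM μ Z x ⊗ₖ pdM μ Z x) = 0)))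
    ∧
    (((∀ x, P x * boxM P x - boxM P x * P x = 0) ∧
        (∀ x, ∑ μ, eta μ •
          ((P x * pdM μ P x - pdM μ P x * P x) ⊗ₖ pdM μ P x
            + pdM μ P x ⊗ₖ (P x * pdM μ P x - pdM μ P x * P x)) = 0))
      ↔ ((∀ (i : Fin p) (j : Fin n) x, boxS (fun y => Z y i j) x = 0) ∧
          (∀ (i k : Fin p) (j l : Fin n) x,
            ∑ μ, eta μ * pd μ (fun y => Z y i j) x * pd μ (fun y => Z y k l) x = 0))) := by
  have key := main_point U hU Z hZ P hP
  have hK : ∀ x, (∑ μ, eta μ • (pdM μ Z x ⊗ₖ pdM μ Z x) = 0) ↔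
      ∀ i k j l, ∑ μ, eta μ * pdM μ Z x i j * pdM μ Z x k l = 0 := by
    intro x
    constructor
    · intro h i k j l
      have := congrFun (congrFun h (i, k)) (j, l)
      simpa [Matrix.sum_apply, mul_assoc] using this
    · intro h
      ext ⟨i, k⟩ ⟨j, l⟩
      simpa [Matrix.sum_apply, mul_assoc] using h i k j l
  have hB : ∀ x, boxM Z x = 0 ↔ ∀ i j, boxS (fun y => Z y i j) x = 0 := by
    intro x
    have e : ∀ i j, boxM Z x i j = boxS (fun y => Z y i j) x := by
      intro i j
      simp only [boxM, boxS, Matrix.sum_apply, Matrix.smul_apply, smul_eq_mul]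
      rfl
    constructor
    · intro h i j
      rw [← e, h]; rfl
    · intro h
      ext i j
      rw [e, h]; rfl
  have main : ((∀ x, P x * boxM P x - boxM P x * P x = 0) ∧
        (∀ x, ∑ μ, eta μ •
          ((P x * pdM μ P x - pdM μ P x * P x) ⊗ₖ pdM μ P x
            + pdM μ P x ⊗ₖ (P x * pdM μ P x - pdM μ P x * P x)) = 0))
      ↔ ((∀ x, boxM Z x = 0) ∧
          (∀ x, ∑ μ, eta μ • (pdM μ Z x ⊗ₖ pdM μ Z x) = 0)) := by
    constructor
    · rintro ⟨h1, h2⟩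
      have h3 := fun x => (key x).1.1 (h2 x)
      exact ⟨fun x => ((key x).2 (h3 x)).1 (h1 x), fun x => (hK x).2 (h3 x)⟩
    · rintro ⟨h1, h2⟩
      have h3 := fun x => (hK x).1 (h2 x)
      exact ⟨fun x => ((key x).2 (h3 x)).2 (h1 x), fun x => (key x).1.2 (h3 x)⟩
  refine ⟨main, main.trans ?_⟩
  constructor
  · rintro ⟨h1, h2⟩
    exact ⟨fun i j x => (hB x).1 (h1 x) i j, fun i k j l x => (hK x).1 (h2 x) i k j l⟩
  · rintro ⟨h1, h2⟩
    exact ⟨fun x => (hB x).2 fun i j => h1 i j x,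
      fun x => (hK x).2 fun i k j l => h2 i k j l x⟩
end
end

section
/- Let Z : ℝ → M(p,n;ℂ) be a differentiable matrix-valued function of a real parameter t. Then the derivative of P_0(Z(t)) := V(Z) · diag(I_n, 0_p) · V(Z)^{-1} is given by d/dt P_0(Z) = W(Z)^{-1} · [[0, Ż†],[Ż, 0]] · V(Z)^{-1}, where Ż := dZ/dt, V(Z) := [[I_n, −Z†],[Z, I_p]] and W(Z) := [[I_n, Z†],[−Z, I_p]] (both invertible for every Z). -/
noncomputable section
open Matrix

/-- Entrywise derivative of a matrix-valued function of a real parameter. -/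
def derM {ι κ : Type*} (Z : ℝ → Matrix ι κ ℂ) (t : ℝ) : Matrix ι κ ℂ :=
  Matrix.of fun i j => deriv (fun s => Z s i j) t

open scoped ComplexOrder in
theorem detV_unit {n p : ℕ} (Z : Matrix (Fin p) (Fin n) ℂ) : IsUnit (Vmat Z).det := by
  have h : (1 + Zᴴ * Z).PosDef := PosDef.one.add_posSemidef (posSemidef_conjTranspose_mul_self Z)
  have := (Matrix.isUnit_iff_isUnit_det _).1 h.isUnit
  simpa [Vmat] using this

open scoped ComplexOrder in
theorem detW_unit {n p : ℕ} (Z : Matrix (Fin p) (Fin n) ℂ) : IsUnit (Wmat Z).det := by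
  have h : (1 + Zᴴ * Z).PosDef := PosDef.one.add_posSemidef (posSemidef_conjTranspose_mul_self Z)
  have := (Matrix.isUnit_iff_isUnit_det _).1 h.isUnit
  simpa [Wmat] using this

section normed
attribute [local instance] Matrix.linftyOpNormedRing Matrix.linftyOpNormedAlgebra

theorem hasDerivAt_matrix {ι : Type*} [Fintype ι] [DecidableEq ι] (A : ℝ → Matrix ι ι ℂ)
    (A' : Matrix ι ι ℂ) (t : ℝ) :
    HasDerivAt A A' t ↔ ∀ i j, HasDerivAt (fun s => A s i j) (A' i j) t := by
  constructor
  · intro h i j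
    exact (LinearMap.toContinuousLinearMap
      (Matrix.entryLinearMap ℝ ℂ i j : Matrix ι ι ℂ →ₗ[ℝ] ℂ)).hasFDerivAt.comp_hasDerivAt t h
  · intro h
    have h2 : HasDerivAt (fun s => ∑ i, ∑ j,
        (LinearMap.toContinuousLinearMap
          (Matrix.singleLinearMap ℝ i j : ℂ →ₗ[ℝ] Matrix ι ι ℂ)) (A s i j))
        (∑ i, ∑ j, (LinearMap.toContinuousLinearMap
          (Matrix.singleLinearMap ℝ i j : ℂ →ₗ[ℝ] Matrix ι ι ℂ)) (A' i j)) t := by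
      refine HasDerivAt.fun_sum fun i _ => HasDerivAt.fun_sum fun j _ => ?_
      exact (LinearMap.toContinuousLinearMap
        (Matrix.singleLinearMap ℝ i j : ℂ →ₗ[ℝ] Matrix ι ι ℂ)).hasFDerivAt.comp_hasDerivAt t (h i j)
    have e : ∀ M : Matrix ι ι ℂ, (∑ i, ∑ j, (LinearMap.toContinuousLinearMap
          (Matrix.singleLinearMap ℝ i j : ℂ →ₗ[ℝ] Matrix ι ι ℂ)) (M i j)) = M := by
      intro M
      exact (Matrix.matrix_eq_sum_single M).symm
    simpa only [e] using h2

theorem deriv_conj {ι : Type*} [Fintype ι] [DecidableEq ι] (A : ℝ → Matrix ι ι ℂ)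
    (A' D : Matrix ι ι ℂ) (t : ℝ) (hA : ∀ i j, HasDerivAt (fun s => A s i j) (A' i j) t)
    (hu : IsUnit (A t).det) :
    derM (fun s => A s * D * (A s)⁻¹) t
      = A' * D * (A t)⁻¹ - A t * D * ((A t)⁻¹ * A' * (A t)⁻¹) := by
  have h := (hasDerivAt_matrix A A' t).2 hA
  obtain ⟨u, hu⟩ := (Matrix.isUnit_iff_isUnit_det _).2 hu
  have hi0 := hasFDerivAt_ringInverse (𝕜 := ℝ) u
  rw [hu] at hi0
  have hi := hi0.comp_hasDerivAt t h
  have hinv : (↑u⁻¹ : Matrix ι ι ℂ) = (A t)⁻¹ := by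
    rw [← hu, Matrix.coe_units_inv]
  have h3 := (h.mul_const D).mul hi
  have h4 := (hasDerivAt_matrix _ _ t).1 h3
  ext i j
  have h5 := (h4 i j).deriv
  simp only [derM, Matrix.of_apply, Matrix.nonsing_inv_eq_ringInverse] at h5 hinv ⊢
  refine Eq.trans h5 ?_
  simp [← hu, mul_assoc, sub_eq_add_neg]

end normed

/-- For a differentiable `Z : ℝ → M(p,n;ℂ)`,
`d/dt P₀(Z) = W(Z)⁻¹ · [[0, Ż†],[Ż, 0]] · V(Z)⁻¹`. -/
theorem statement4 {n p : ℕ} (Z : ℝ → Matrix (Fin p) (Fin n) ℂ)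
    (hZ : ∀ i j, Differentiable ℝ fun t => Z t i j) (t : ℝ) :
    derM (fun s => P0 (Z s)) t
      = (Wmat (Z t))⁻¹ * Matrix.fromBlocks 0 (derM Z t)ᴴ (derM Z t) 0 * (Vmat (Z t))⁻¹ := by
  have hd : ∀ i j, HasDerivAt (fun s => Z s i j) (derM Z t i j) t := fun i j =>
    (hZ i j t).hasDerivAt
  have key := deriv_conj (fun s => Vmat (Z s))
    (Matrix.fromBlocks 0 (-(derM Z t)ᴴ) (derM Z t) 0) (Matrix.fromBlocks 1 0 0 0) t ?_
    (detV_unit (Z t))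
  · refine Eq.trans key ?_
    have hV := detV_unit (Z t)
    have hW := detW_unit (Z t)
    have hc : Wmat (Z t) * Vmat (Z t) * Matrix.fromBlocks 1 0 0 0
        = Matrix.fromBlocks 1 0 0 0 * Wmat (Z t) * Vmat (Z t) := by
      simp [Wmat, Vmat, Matrix.fromBlocks_multiply]
    have hc2 : Wmat (Z t) * (Vmat (Z t) * Matrix.fromBlocks 1 0 0 0 * (Vmat (Z t))⁻¹)
        = Matrix.fromBlocks 1 0 0 0 * Wmat (Z t) := by
      rw [← mul_assoc, ← mul_assoc, hc, Matrix.mul_nonsing_inv_cancel_right _ _ hV]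
    have hm : Matrix.fromBlocks 0 (derM Z t)ᴴ (derM Z t) 0
        = Wmat (Z t) * (Matrix.fromBlocks 0 (-(derM Z t)ᴴ) (derM Z t) 0
            * Matrix.fromBlocks 1 0 0 0)
          - Matrix.fromBlocks 1 0 0 0 * Wmat (Z t)
            * Matrix.fromBlocks 0 (-(derM Z t)ᴴ) (derM Z t) 0 := by
      simp [Wmat, Matrix.fromBlocks_multiply, sub_eq_add_neg, Matrix.fromBlocks_neg,
        Matrix.fromBlocks_add]
    rw [hm, ← hc2, mul_assoc (Wmat (Z t)), ← mul_sub, Matrix.nonsing_inv_mul_cancel_left _ _ hW,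
      sub_mul]
    simp only [mul_assoc]
  · rintro (i | i) (j | j)
    · simpa [Vmat] using hasDerivAt_const t _
    · simpa [Vmat] using (hd j i).star.fun_neg
    · simpa [Vmat] using hd i j
    · simpa [Vmat] using hasDerivAt_const t _
end
end

section
/- Let Z : ℝ → M(p,n;ℂ) be a differentiable matrix-valued function of a real parameter t and set P_0(Z) := V(Z) · diag(I_n, 0_p) · V(Z)^{-1} with V(Z) := [[I_n, −Z†],[Z, I_p]] and W(Z) := [[I_n, Z†],[−Z, I_p]]. Then the commutator [P_0(Z), d/dt P_0(Z)] = W(Z)^{-1} · [[0, Ż†],[−Ż, 0]] · V(Z)^{-1}, where Ż := dZ/dt. -/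
noncomputable section
open Matrix

open scoped ComplexOrder in
theorem VW_posDef {n p : ℕ} (Z : Matrix (Fin p) (Fin n) ℂ) :
    IsUnit (Vmat Z).det ∧ IsUnit (Wmat Z).det := by
  have h : Wmat Z * Vmat Z = Matrix.fromBlocks (1 + Zᴴ * Z) 0 0 (1 + Z * Zᴴ) := by
    simp [Vmat, Wmat, Matrix.fromBlocks_multiply, add_comm]
  have h1 : (1 + Zᴴ * Z).PosDef :=
    Matrix.PosDef.one.add_posSemidef (Matrix.posSemidef_conjTranspose_mul_self Z)
  have h2 : (1 + Z * Zᴴ).PosDef :=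
    Matrix.PosDef.one.add_posSemidef (Matrix.posSemidef_self_mul_conjTranspose Z)
  have h3 : IsUnit ((Wmat Z).det * (Vmat Z).det) := by
    rw [← Matrix.det_mul, h, Matrix.det_fromBlocks_zero₂₁]
    exact ((Matrix.isUnit_iff_isUnit_det _).1 h1.isUnit).mul
      ((Matrix.isUnit_iff_isUnit_det _).1 h2.isUnit)
  rw [IsUnit.mul_iff] at h3
  exact ⟨h3.2, h3.1⟩


theorem inv_entry_diff {ι : Type*} [Fintype ι] [DecidableEq ι] (V : ℝ → Matrix ι ι ℂ)
    (hV : ∀ i j, Differentiable ℝ fun s => V s i j) (hu : ∀ s, IsUnit (V s).det) (i j : ι) :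
    Differentiable ℝ fun s => (V s)⁻¹ i j := by
  have hdet : ∀ M : ℝ → Matrix ι ι ℂ, (∀ i j, Differentiable ℝ fun s => M s i j) →
      Differentiable ℝ fun s => (M s).det := by
    intro M hM
    simp only [Matrix.det_apply']
    fun_prop
  simp only [Matrix.inv_def, Ring.inverse_eq_inv', Matrix.smul_apply, smul_eq_mul,
    Matrix.adjugate_apply]
  refine Differentiable.mul ?_ ?_
  · exact (hdet V hV).fun_inv (fun s => (hu s).ne_zero)
  · apply hdet
    intro k l
    simp only [Matrix.updateRow_apply]
    split_ifs
    · fun_prop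
    · exact hV k l

theorem derM_mul {ι κ μ : Type*} [Fintype κ] (A : ℝ → Matrix ι κ ℂ) (B : ℝ → Matrix κ μ ℂ)
    (hA : ∀ i j, Differentiable ℝ fun s => A s i j)
    (hB : ∀ i j, Differentiable ℝ fun s => B s i j) (t : ℝ) :
    derM (fun s => A s * B s) t = derM A t * B t + A t * derM B t := by
  ext i j
  simp only [derM, Matrix.of_apply, Matrix.mul_apply, Matrix.add_apply]
  rw [← Finset.sum_add_distrib]
  refine HasDerivAt.deriv ?_
  apply HasDerivAt.fun_sum
  intro k _
  exact (hA i k t).hasDerivAt.mul (hB k j t).hasDerivAt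

theorem Vmat_diff {n p : ℕ} (Z : ℝ → Matrix (Fin p) (Fin n) ℂ)
    (hZ : ∀ i j, Differentiable ℝ fun t => Z t i j) (i j) :
    Differentiable ℝ fun s => Vmat (Z s) i j := by
  rcases i with i | i <;> rcases j with j | j <;> simp only [Vmat, Matrix.fromBlocks_apply₁₁,
    Matrix.fromBlocks_apply₁₂, Matrix.fromBlocks_apply₂₁, Matrix.fromBlocks_apply₂₂,
    Matrix.neg_apply, Matrix.conjTranspose_apply]
  · fun_prop
  · exact (hZ j i).star.neg
  · exact hZ i j
  · fun_prop

theorem derM_Vmat {n p : ℕ} (Z : ℝ → Matrix (Fin p) (Fin n) ℂ) (t : ℝ) :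
    derM (fun s => Vmat (Z s)) t = Matrix.fromBlocks 0 (-(derM Z t)ᴴ) (derM Z t) 0 := by
  ext i j
  rcases i with i | i <;> rcases j with j | j <;> simp [derM, Vmat]
  exact deriv.star (f := fun s => Z s j i) (x := t)

/-- For a differentiable `Z : ℝ → M(p,n;ℂ)`,
`[P₀(Z), d/dt P₀(Z)] = W(Z)⁻¹ · [[0, Ż†],[-Ż, 0]] · V(Z)⁻¹`. -/
theorem statement5 {n p : ℕ} (Z : ℝ → Matrix (Fin p) (Fin n) ℂ)
    (hZ : ∀ i j, Differentiable ℝ fun t => Z t i j) (t : ℝ) :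
    P0 (Z t) * derM (fun s => P0 (Z s)) t - derM (fun s => P0 (Z s)) t * P0 (Z t)
      = (Wmat (Z t))⁻¹ * Matrix.fromBlocks 0 (derM Z t)ᴴ (-(derM Z t)) 0
          * (Vmat (Z t))⁻¹ := by
  have hV := fun s => (VW_posDef (Z s)).1
  have hW := (VW_posDef (Z t)).2
  have hVd := Vmat_diff Z hZ
  have hid := inv_entry_diff _ hVd hV
  set E : Matrix (Fin n ⊕ Fin p) (Fin n ⊕ Fin p) ℂ := Matrix.fromBlocks 1 0 0 0 with hE
  have hPV : ∀ s, P0 (Z s) * Vmat (Z s) = Vmat (Z s) * E := fun s => by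
    rw [P0, Matrix.nonsing_inv_mul_cancel_right _ _ (hV s)]
  have hVE : ∀ i j, Differentiable ℝ fun s => (Vmat (Z s) * E) i j := by
    intro i j
    simp only [Matrix.mul_apply]
    fun_prop
  have hPd : ∀ i j, Differentiable ℝ fun s => P0 (Z s) i j := by
    intro i j
    have h : (fun s => P0 (Z s) i j)
        = fun s => ∑ k, (Vmat (Z s) * E) i k * (Vmat (Z s))⁻¹ k j := by
      funext s
      rw [P0, Matrix.mul_apply]
    rw [h]
    exact Differentiable.fun_sum fun k _ => (hVE i k).mul (hid k j)
  have e1 := derM_mul (fun s => P0 (Z s)) (fun s => Vmat (Z s)) hPd hVd t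
  have e2 := derM_mul (fun s => Vmat (Z s)) (fun _ => E) hVd
    (fun i j => differentiable_const _) t
  have hE0 : derM (fun _ : ℝ => E) t = 0 := by ext i j; simp [derM]
  simp only [hPV] at e1
  rw [e1, hE0, Matrix.mul_zero, add_zero, derM_Vmat] at e2
  have hPVt := hPV t
  have hVt := hV t
  have hblk : E * (Wmat (Z t) * Vmat (Z t)) = (Wmat (Z t) * Vmat (Z t)) * E := by
    simp [hE, Vmat, Wmat, Matrix.fromBlocks_multiply]
  set D := derM Z t
  set F : Matrix (Fin n ⊕ Fin p) (Fin n ⊕ Fin p) ℂ := Matrix.fromBlocks 0 (-Dᴴ) D 0 with hF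
  have hblk2 : E * (Wmat (Z t) * F) * E + E * (Wmat (Z t) * F) * E - E * (Wmat (Z t) * F)
      - (Wmat (Z t) * F) * E = Matrix.fromBlocks 0 Dᴴ (-D) 0 := by
    simp [hE, hF, Wmat, Matrix.fromBlocks_multiply, Matrix.fromBlocks_add, sub_eq_add_neg,
      Matrix.fromBlocks_neg]
  set V := Vmat (Z t)
  set W := Wmat (Z t)
  set P := P0 (Z t)
  set P' := derM (fun s => P0 (Z s)) t
  have hWP : W * P = E * W := by
    have : W * P * V = E * W * V := by
      rw [Matrix.mul_assoc, hPVt, Matrix.mul_assoc, hblk, Matrix.mul_assoc]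
    simpa [Matrix.mul_nonsing_inv_cancel_right _ _ hVt] using congrArg (· * V⁻¹) this
  have hP'V : P' * V = F * E - P * F := eq_sub_of_add_eq e2
  have key : W * (P * P' - P' * P) * V = Matrix.fromBlocks 0 Dᴴ (-D) 0 := by
    have hWPV : W * (P' * V) = W * F * E - E * W * F := by
      rw [hP'V, Matrix.mul_sub, ← Matrix.mul_assoc, ← Matrix.mul_assoc, hWP]
    have hEE : E * E = E := by simp [hE, Matrix.fromBlocks_multiply]
    calc W * (P * P' - P' * P) * V = (W * P) * (P' * V) - W * P' * (P * V) := by noncomm_ring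
      _ = E * (W * (P' * V)) - (W * (P' * V)) * E := by rw [hWP, hPVt]; noncomm_ring
      _ = E * (W * F) * E + E * (W * F) * E - (E * E) * (W * F) - (W * F) * (E * E) := by
        rw [hWPV]; noncomm_ring
      _ = _ := by rw [hEE, hblk2]
  rw [← key, Matrix.mul_assoc W, Matrix.nonsing_inv_mul_cancel_left _ _ hW,
    Matrix.mul_nonsing_inv_cancel_right _ _ hVt]
end
end

section
/- Let P : M^{1+m} → M(N;ℂ) be a twice continuously differentiable matrix-valued function satisfying P² = P pointwise. Then [P ⊗ P, □(P ⊗ P)] = [P, □P] ⊗ P + P ⊗ [P, □P] + [P, ∂_μP] ⊗ ∂^μP + ∂^μP ⊗ [P, ∂_μP], where ⊗ is the Kronecker product and repeated μ indices denote Minkowski contraction. Consequently, P satisfies both [P, □P] = 0 and [P, ∂_μP] ⊗ ∂^μP + ∂^μP ⊗ [P, ∂_μP] = 0 (the submodel equations) if and only if P satisfies both [P, □P] = 0 and [P ⊗ P, □(P ⊗ P)] = 0. -/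
/-!
`(1+m)`-dimensional Minkowski space `M^{1+m}` is modeled as `Fin (m+1) → ℝ` with
coordinates `x 0, x 1, ..., x m` and metric `η = diag(1, -1, ..., -1)`.
`pd μ f` is the partial derivative `∂_μ f`, `pdM` its entrywise matrix version,
`boxS`/`boxM` the d'Alembertian `□ = ∂_0² - Σ_{k=1}^m ∂_k²`, and contractions over a
repeated index `μ` are written as `∑ μ, eta μ * ⋯` (resp. `eta μ • ⋯`).
-/

noncomputable section
open Matrix
open scoped Kronecker

theorem aux_pd_mul {m : ℕ} (μ : Fin (m + 1)) {f g : Spacetime m → ℂ}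
    (hf : Differentiable ℝ f) (hg : Differentiable ℝ g) (x : Spacetime m) :
    pd μ (fun y => f y * g y) x = pd μ f x * g x + f x * pd μ g x := by
  unfold pd
  rw [fderiv_fun_mul (hf x) (hg x)]
  simp only [ContinuousLinearMap.add_apply, ContinuousLinearMap.smul_apply, smul_eq_mul]
  ring

theorem aux_pd_add {m : ℕ} (μ : Fin (m + 1)) {f g : Spacetime m → ℂ}
    (hf : Differentiable ℝ f) (hg : Differentiable ℝ g) (x : Spacetime m) :
    pd μ (fun y => f y + g y) x = pd μ f x + pd μ g x := by
  unfold pd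
  rw [fderiv_fun_add (hf x) (hg x)]
  simp only [ContinuousLinearMap.add_apply]

theorem aux_pd_diff {m : ℕ} (μ : Fin (m + 1)) {f : Spacetime m → ℂ}
    (hf : ContDiff ℝ 2 f) : Differentiable ℝ (pd μ f) := by
  have h : ContDiff ℝ 1 (fderiv ℝ f) := hf.fderiv_right (by norm_num)
  have h2 := h.differentiable (by norm_num)
  intro x
  exact (h2 x).clm_apply (differentiableAt_const _)

theorem aux_pd_pd_mul {m : ℕ} (μ : Fin (m + 1)) {f g : Spacetime m → ℂ}
    (hf : ContDiff ℝ 2 f) (hg : ContDiff ℝ 2 g) (x : Spacetime m) :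
    pd μ (pd μ (fun y => f y * g y)) x
      = pd μ (pd μ f) x * g x + 2 * (pd μ f x * pd μ g x) + f x * pd μ (pd μ g) x := by
  have df := hf.differentiable (by norm_num)
  have dg := hg.differentiable (by norm_num)
  have ddf := aux_pd_diff μ hf
  have ddg := aux_pd_diff μ hg
  have h1 : pd μ (fun y => f y * g y) = fun y => pd μ f y * g y + f y * pd μ g y :=
    funext fun y => aux_pd_mul μ df dg y
  rw [h1, aux_pd_add μ (ddf.fun_mul dg) (df.fun_mul ddg), aux_pd_mul μ ddf dg, aux_pd_mul μ df ddg]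
  ring

theorem aux_leibniz {m N : ℕ} (P : Spacetime m → Matrix (Fin N) (Fin N) ℂ)
    (hP : ∀ i j, ContDiff ℝ 2 fun x => P x i j)
    (hproj : ∀ x, P x * P x = P x) (μ : Fin (m + 1)) (x : Spacetime m) :
    pdM μ P x * P x + P x * pdM μ P x = pdM μ P x := by
  have d := fun i j => (hP i j).differentiable (by norm_num : (2 : WithTop ℕ∞) ≠ 0)
  ext i j
  have h1 : (fun y => P y i j) = fun y => ∑ k, P y i k * P y k j := by
    funext y
    conv_lhs => rw [← hproj y]
    rw [Matrix.mul_apply]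
  have h2 : pd μ (fun y => P y i j) x
      = ∑ k, (pd μ (fun y => P y i k) x * P x k j + P x i k * pd μ (fun y => P y k j) x) := by
    conv_lhs => rw [h1]
    have h3 : pd μ (fun y => ∑ k, P y i k * P y k j) x
        = ∑ k, pd μ (fun y => P y i k * P y k j) x := by
      unfold pd
      rw [fderiv_fun_sum (fun k _ => ((d i k).fun_mul (d k j)) x)]
      simp only [ContinuousLinearMap.sum_apply]
    rw [h3]
    exact Finset.sum_congr rfl fun k _ => aux_pd_mul μ (d i k) (d k j) x
  simp only [Matrix.add_apply, Matrix.mul_apply, pdM, Matrix.of_apply]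
  rw [h2, Finset.sum_add_distrib]

theorem aux_pdM_kron {m N : ℕ} (P : Spacetime m → Matrix (Fin N) (Fin N) ℂ)
    (hP : ∀ i j, ContDiff ℝ 2 fun x => P x i j) (μ : Fin (m + 1)) (x : Spacetime m) :
    pdM μ (pdM μ (fun y => P y ⊗ₖ P y)) x
      = pdM μ (pdM μ P) x ⊗ₖ P x + (2 : ℂ) • (pdM μ P x ⊗ₖ pdM μ P x)
        + P x ⊗ₖ pdM μ (pdM μ P) x := by
  ext ⟨i, k⟩ ⟨j, l⟩
  exact aux_pd_pd_mul μ (hP i j) (hP k l) x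

theorem aux_alg {N : ℕ} (p a b : Matrix (Fin N) (Fin N) ℂ) (hp : p * p = p)
    (ha : a * p + p * a = a) :
    (p ⊗ₖ p) * (b ⊗ₖ p + (2 : ℂ) • (a ⊗ₖ a) + p ⊗ₖ b)
      - (b ⊗ₖ p + (2 : ℂ) • (a ⊗ₖ a) + p ⊗ₖ b) * (p ⊗ₖ p)
    = (p * b - b * p) ⊗ₖ p + p ⊗ₖ (p * b - b * p)
      + ((p * a - a * p) ⊗ₖ a + a ⊗ₖ (p * a - a * p)) := by
  have h : (p * a - a * p) ⊗ₖ a + a ⊗ₖ (p * a - a * p)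
      = (p * a - a * p) ⊗ₖ (a * p + p * a) + (a * p + p * a) ⊗ₖ (p * a - a * p) := by
    rw [ha]
  rw [h]
  simp only [mul_add, add_mul, mul_smul_comm, smul_mul_assoc, ← Matrix.mul_kronecker_mul, hp]
  ext ⟨i, k⟩ ⟨j, l⟩
  simp only [Matrix.add_apply, Matrix.sub_apply, Matrix.smul_apply, Matrix.kroneckerMap_apply,
    smul_eq_mul]
  ring

theorem aux_main {m N : ℕ} (P : Spacetime m → Matrix (Fin N) (Fin N) ℂ)
    (hP : ∀ i j, ContDiff ℝ 2 fun x => P x i j)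
    (hproj : ∀ x, P x * P x = P x) (x : Spacetime m) :
      (P x ⊗ₖ P x) * boxM (fun y => P y ⊗ₖ P y) x
          - boxM (fun y => P y ⊗ₖ P y) x * (P x ⊗ₖ P x)
        = (P x * boxM P x - boxM P x * P x) ⊗ₖ P x
          + P x ⊗ₖ (P x * boxM P x - boxM P x * P x)
          + ∑ μ, eta μ •
              ((P x * pdM μ P x - pdM μ P x * P x) ⊗ₖ pdM μ P x
                + pdM μ P x ⊗ₖ (P x * pdM μ P x - pdM μ P x * P x)) := by
  have hc : P x * boxM P x - boxM P x * P x
      = ∑ μ, eta μ • (P x * pdM μ (pdM μ P) x - pdM μ (pdM μ P) x * P x) := by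
    simp only [boxM, Finset.mul_sum, Finset.sum_mul, mul_smul_comm, smul_mul_assoc, smul_sub,
      Finset.sum_sub_distrib]
  have hl : ∀ c : Fin (m + 1) → Matrix (Fin N) (Fin N) ℂ,
      (∑ μ, eta μ • c μ) ⊗ₖ P x = ∑ μ, eta μ • (c μ ⊗ₖ P x) := by
    intro c
    ext ⟨i, k⟩ ⟨j, l⟩
    simp only [Matrix.sum_apply, Matrix.smul_apply, Matrix.kroneckerMap_apply, smul_eq_mul,
      Finset.sum_mul, mul_assoc]
  have hr : ∀ c : Fin (m + 1) → Matrix (Fin N) (Fin N) ℂ,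
      P x ⊗ₖ (∑ μ, eta μ • c μ) = ∑ μ, eta μ • (P x ⊗ₖ c μ) := by
    intro c
    ext ⟨i, k⟩ ⟨j, l⟩
    simp only [Matrix.sum_apply, Matrix.smul_apply, Matrix.kroneckerMap_apply, smul_eq_mul,
      Finset.mul_sum, mul_left_comm]
  rw [hc, hl, hr, ← Finset.sum_add_distrib, ← Finset.sum_add_distrib]
  unfold boxM
  rw [Finset.mul_sum, Finset.sum_mul, ← Finset.sum_sub_distrib]
  refine Finset.sum_congr rfl fun μ _ => ?_
  rw [mul_smul_comm, smul_mul_assoc, ← smul_sub, ← smul_add, ← smul_add, aux_pdM_kron P hP,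
    aux_alg _ _ _ (hproj x) (aux_leibniz P hP hproj μ x)]

/-- For any `C²` matrix-valued `P` with `P² = P` pointwise,
`[P⊗P, □(P⊗P)] = [P,□P] ⊗ P + P ⊗ [P,□P] + [P,∂_μP] ⊗ ∂^μP + ∂^μP ⊗ [P,∂_μP]`;
consequently the submodel equations (`[P,□P] = 0` together with
`[P,∂_μP] ⊗ ∂^μP + ∂^μP ⊗ [P,∂_μP] = 0`) hold iff `[P,□P] = 0` and
`[P⊗P, □(P⊗P)] = 0`. -/
theorem statement12 {m N : ℕ} (P : Spacetime m → Matrix (Fin N) (Fin N) ℂ)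
    (hP : ∀ i j, ContDiff ℝ 2 fun x => P x i j)
    (hproj : ∀ x, P x * P x = P x) :
    (∀ x,
      (P x ⊗ₖ P x) * boxM (fun y => P y ⊗ₖ P y) x
          - boxM (fun y => P y ⊗ₖ P y) x * (P x ⊗ₖ P x)
        = (P x * boxM P x - boxM P x * P x) ⊗ₖ P x
          + P x ⊗ₖ (P x * boxM P x - boxM P x * P x)
          + ∑ μ, eta μ •
              ((P x * pdM μ P x - pdM μ P x * P x) ⊗ₖ pdM μ P x
                + pdM μ P x ⊗ₖ (P x * pdM μ P x - pdM μ P x * P x)))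
    ∧
    (((∀ x, P x * boxM P x - boxM P x * P x = 0) ∧
        (∀ x, ∑ μ, eta μ •
          ((P x * pdM μ P x - pdM μ P x * P x) ⊗ₖ pdM μ P x
            + pdM μ P x ⊗ₖ (P x * pdM μ P x - pdM μ P x * P x)) = 0))
      ↔ ((∀ x, P x * boxM P x - boxM P x * P x = 0) ∧
          (∀ x, (P x ⊗ₖ P x) * boxM (fun y => P y ⊗ₖ P y) x
              - boxM (fun y => P y ⊗ₖ P y) x * (P x ⊗ₖ P x) = 0))) := by
  refine ⟨aux_main P hP hproj, and_congr_right fun h => forall_congr' fun x => ?_⟩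
  rw [aux_main P hP hproj x, h x]
  simp only [Matrix.zero_kronecker, Matrix.kronecker_zero, zero_add]
end
end
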